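/- arXiv:1708.05802 — 2 statements merged into one kernel-verified Lean document; each statement's English description precedes it below -/
import Mathlib

section
/- Let Gr₊₊ be the Grassmannian of oriented positive 2-planes in (V,q) of signature (a,b), a ≥ 2, identified with the open subset {l ∈ P(V_ℂ) : q(l,l)=0, q(l,l̄)>0} of a complex quadric. Fix v with q(v,v) > 0, and let γ_v be the composition of the map induced by the reflection ι_v with orientation reversal. Then γ_v is an antiholomorphic involution of Gr₊₊ whose fixed point set is exactly the set Gr₊₊(v) of oriented positive 2-planes containing v. -/
open Module TensorProduct

/-- The bilinear form `B` has signature `(a, b)`. -/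
def HasSignature {V : Type*} [AddCommGroup V] [Module ℝ V]
    (B : LinearMap.BilinForm ℝ V) (a b : ℕ) : Prop :=
  ∃ e : Basis (Fin a ⊕ Fin b) ℝ V,
    (∀ i, B (e (Sum.inl i)) (e (Sum.inl i)) = 1) ∧
    (∀ j, B (e (Sum.inr j)) (e (Sum.inr j)) = -1) ∧
    (∀ i j, i ≠ j → B (e i) (e j) = 0)

/-- The reflection `x ↦ x - 2 q(x,v)/q(v,v) · v` associated to a vector `v`. -/
noncomputable def reflVec {V : Type*} [AddCommGroup V] [Module ℝ V]
    (B : LinearMap.BilinForm ℝ V) (v : V) : Module.End ℝ V :=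
  LinearMap.id - (2 * (B v v)⁻¹) • ((LinearMap.toSpanSingleton ℝ V v).comp (B.flip v))

/-- Complex conjugation on the complexification `ℂ ⊗ℝ V`. -/
noncomputable def conjC (V : Type*) [AddCommGroup V] [Module ℝ V] :
    (ℂ ⊗[ℝ] V) →ₗ[ℝ] (ℂ ⊗[ℝ] V) :=
  LinearMap.rTensor V Complex.conjAe.toLinearMap

/-- The real part map `ℂ ⊗ℝ V → V`. -/
noncomputable def reC (V : Type*) [AddCommGroup V] [Module ℝ V] :
    (ℂ ⊗[ℝ] V) →ₗ[ℝ] V :=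
  (TensorProduct.lid ℝ V).toLinearMap.comp (LinearMap.rTensor V Complex.reLm)

/-- Membership of a complex line in the period domain
`{l : q(l,l) = 0, q(l,l̄) > 0}`. -/
def InPer {V : Type*} [AddCommGroup V] [Module ℝ V]
    (Bc : LinearMap.BilinForm ℂ (ℂ ⊗[ℝ] V)) (l : Submodule ℂ (ℂ ⊗[ℝ] V)) : Prop :=
  Module.finrank ℂ l = 1 ∧ (∀ w ∈ l, Bc w w = 0) ∧
    (∀ w ∈ l, w ≠ 0 →
      (Bc w (conjC V w)).im = 0 ∧ 0 < (Bc w (conjC V w)).re)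

section

variable {V : Type*} [AddCommGroup V] [Module ℝ V]

theorem reflVec_apply (B : LinearMap.BilinForm ℝ V) (v x : V) :
    reflVec B v x = x - (2 * (B v v)⁻¹) • B x v • v := by
  simp [reflVec]

theorem reflVec_reflVec (B : LinearMap.BilinForm ℝ V) {v : V} (hv : B v v ≠ 0) (x : V) :
    reflVec B v (reflVec B v x) = x := by
  simp only [reflVec_apply, map_sub, map_smul]
  match_scalars <;> field_simp
  ring

theorem apply_reflVec_reflVec {B : LinearMap.BilinForm ℝ V} (hB : B.IsSymm) {v : V}
    (hv : B v v ≠ 0) (x y : V) : B (reflVec B v x) (reflVec B v y) = B x y := by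
  have h : B v y = B y v := hB.eq v y
  simp only [reflVec_apply, map_sub, map_smul, LinearMap.sub_apply, LinearMap.smul_apply,
    smul_eq_mul, h]
  field_simp
  ring

theorem conjC_tmul (c : ℂ) (x : V) : conjC V (c ⊗ₜ x) = (starRingEnd ℂ) c ⊗ₜ x := by
  simp [conjC]

theorem reC_tmul (c : ℂ) (x : V) : reC V (c ⊗ₜ x) = c.re • x := by
  simp [reC]

theorem exists_eq_one_tmul_reC_add_I_tmul (w : ℂ ⊗[ℝ] V) :
    ∃ y : V, w = (1 : ℂ) ⊗ₜ[ℝ] reC V w + Complex.I ⊗ₜ[ℝ] y := by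
  induction w with
  | zero => exact ⟨0, by simp⟩
  | tmul c x =>
    refine ⟨c.im • x, ?_⟩
    rw [reC_tmul, ← TensorProduct.smul_tmul, ← TensorProduct.smul_tmul, ← TensorProduct.add_tmul]
    congr 1
    apply Complex.ext <;> simp
  | add w₁ w₂ h₁ h₂ =>
    obtain ⟨y₁, h₁⟩ := h₁
    obtain ⟨y₂, h₂⟩ := h₂
    refine ⟨y₁ + y₂, ?_⟩
    rw [map_add, TensorProduct.tmul_add, TensorProduct.tmul_add]
    nth_rewrite 1 [h₁, h₂]
    abel

/-- The composition of complex conjugation with the complexified reflection in `v`. -/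
noncomputable def conjRefl (B : LinearMap.BilinForm ℝ V) (v : V) :
    (ℂ ⊗[ℝ] V) →ₗ[ℝ] (ℂ ⊗[ℝ] V) :=
  (conjC V).comp ((LinearMap.baseChange ℂ (reflVec B v)).restrictScalars ℝ)

theorem conjRefl_tmul (B : LinearMap.BilinForm ℝ V) (v : V) (c : ℂ) (x : V) :
    conjRefl B v (c ⊗ₜ x) = (starRingEnd ℂ) c ⊗ₜ reflVec B v x := by
  simp [conjRefl, conjC_tmul]

theorem conjRefl_smul (B : LinearMap.BilinForm ℝ V) (v : V) (c : ℂ) (w : ℂ ⊗[ℝ] V) :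
    conjRefl B v (c • w) = (starRingEnd ℂ) c • conjRefl B v w := by
  induction w with
  | zero => simp
  | tmul d x => simp [TensorProduct.smul_tmul', conjRefl_tmul]
  | add w₁ w₂ h₁ h₂ => simp only [smul_add, map_add, h₁, h₂]

theorem conjRefl_conjRefl (B : LinearMap.BilinForm ℝ V) {v : V} (hv : B v v ≠ 0)
    (w : ℂ ⊗[ℝ] V) : conjRefl B v (conjRefl B v w) = w := by
  induction w with
  | zero => simp
  | tmul d x => simp [conjRefl_tmul, reflVec_reflVec B hv]
  | add w₁ w₂ h₁ h₂ => simp only [map_add, h₁, h₂]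

theorem conjC_conjRefl (B : LinearMap.BilinForm ℝ V) (v : V) (w : ℂ ⊗[ℝ] V) :
    conjC V (conjRefl B v w) = conjRefl B v (conjC V w) := by
  induction w with
  | zero => simp
  | tmul d x => simp [conjRefl_tmul, conjC_tmul]
  | add w₁ w₂ h₁ h₂ => simp only [map_add, h₁, h₂]

theorem baseChange_conjRefl {B : LinearMap.BilinForm ℝ V} (hB : B.IsSymm) {v : V}
    (hv : B v v ≠ 0) (w w' : ℂ ⊗[ℝ] V) :
    LinearMap.BilinForm.baseChange ℂ B (conjRefl B v w) (conjRefl B v w') =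
      (starRingEnd ℂ) (LinearMap.BilinForm.baseChange ℂ B w w') := by
  induction w with
  | zero => simp
  | add w₁ w₂ h₁ h₂ => simp only [map_add, LinearMap.add_apply, h₁, h₂]
  | tmul c x =>
    induction w' with
    | zero => simp
    | add w₁ w₂ h₁ h₂ => simp only [map_add, h₁, h₂]
    | tmul d y =>
      simp [conjRefl_tmul, LinearMap.BilinForm.baseChange_tmul, apply_reflVec_reflVec hB hv]

/-- The image of a complex subspace under `conjRefl B v`. -/
noncomputable def conjReflImage (B : LinearMap.BilinForm ℝ V) (v : V)
    (l : Submodule ℂ (ℂ ⊗[ℝ] V)) : Submodule ℂ (ℂ ⊗[ℝ] V) where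
  carrier := conjRefl B v '' l
  add_mem' := by
    rintro _ _ ⟨x, hx, rfl⟩ ⟨y, hy, rfl⟩
    exact ⟨x + y, l.add_mem hx hy, map_add _ _ _⟩
  zero_mem' := ⟨0, l.zero_mem, map_zero _⟩
  smul_mem' := by
    rintro c _ ⟨x, hx, rfl⟩
    exact ⟨(starRingEnd ℂ) c • x, l.smul_mem _ hx, by simp [conjRefl_smul]⟩

theorem exists_span_singleton_of_finrank_eq_one {M : Type*} [AddCommGroup M] [Module ℂ M]
    {l : Submodule ℂ M} (h : finrank ℂ l = 1) :
    ∃ w, w ≠ 0 ∧ l = Submodule.span ℂ {w} := by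
  obtain ⟨w, hw, hl⟩ := finrank_eq_one_iff'.1 h
  refine ⟨w, by simpa using hw, le_antisymm (fun x hx => ?_) ?_⟩
  · obtain ⟨c, hc⟩ := hl ⟨x, hx⟩
    exact Submodule.mem_span_singleton.2 ⟨c, congrArg Subtype.val hc⟩
  · simp

theorem InPer.conjReflImage {B : LinearMap.BilinForm ℝ V} (hB : B.IsSymm) {v : V}
    (hv : B v v ≠ 0) {l : Submodule ℂ (ℂ ⊗[ℝ] V)}
    (hl : InPer (LinearMap.BilinForm.baseChange ℂ B) l) :
    InPer (LinearMap.BilinForm.baseChange ℂ B) (conjReflImage B v l) := by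
  obtain ⟨h₁, h₂, h₃⟩ := hl
  refine ⟨?_, ?_, ?_⟩
  · obtain ⟨w, hw, rfl⟩ := exists_span_singleton_of_finrank_eq_one h₁
    have hw' : conjRefl B v w ≠ 0 := fun h => hw <| by
      rw [← conjRefl_conjRefl B hv w, h, map_zero]
    suffices h : _root_.conjReflImage B v (Submodule.span ℂ {w}) =
        Submodule.span ℂ {conjRefl B v w} by
      rw [h, finrank_span_singleton hw']
    apply le_antisymm
    · rintro _ ⟨x, hx, rfl⟩
      obtain ⟨c, rfl⟩ := Submodule.mem_span_singleton.1 hx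
      exact Submodule.mem_span_singleton.2 ⟨_, (conjRefl_smul B v c w).symm⟩
    · rw [Submodule.span_singleton_le_iff_mem]
      exact ⟨w, Submodule.mem_span_singleton_self w, rfl⟩
  · rintro _ ⟨x, hx, rfl⟩
    rw [baseChange_conjRefl hB hv, h₂ x hx, map_zero]
  · rintro _ ⟨x, hx, rfl⟩ hne
    have hx0 : x ≠ 0 := fun h => hne (by rw [h, map_zero])
    obtain ⟨him, hre⟩ := h₃ x hx hx0
    rw [conjC_conjRefl, baseChange_conjRefl hB hv]
    exact ⟨by simp [him], by simpa using hre⟩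

/-- A nonzero vector of an isotropic positive line has nonzero real part. -/
theorem InPer.reC_ne_zero {B : LinearMap.BilinForm ℝ V} {l : Submodule ℂ (ℂ ⊗[ℝ] V)}
    (hl : InPer (LinearMap.BilinForm.baseChange ℂ B) l) {u : ℂ ⊗[ℝ] V} (hu : u ∈ l)
    (hu0 : u ≠ 0) : reC V u ≠ 0 := by
  intro h
  obtain ⟨y, hy⟩ := exists_eq_one_tmul_reC_add_I_tmul u
  rw [h, TensorProduct.tmul_zero, zero_add] at hy
  have h₁ := hl.2.1 u hu
  have h₂ := (hl.2.2 u hu hu0).2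
  rw [hy] at h₁ h₂
  simp [conjC_tmul, LinearMap.BilinForm.baseChange_tmul] at h₁ h₂
  exact h₂.ne' h₁

theorem reC_conjRefl (B : LinearMap.BilinForm ℝ V) (v : V) (u : ℂ ⊗[ℝ] V) :
    reC V (conjRefl B v u) = reflVec B v (reC V u) := by
  induction u with
  | zero => simp
  | tmul c x => simp [conjRefl_tmul, reC_tmul]
  | add w₁ w₂ h₁ h₂ => simp only [map_add, h₁, h₂]

theorem InPer.mem_map_reC_of_image_eq {B : LinearMap.BilinForm ℝ V} {v : V}
    (hv : B v v ≠ 0) {l : Submodule ℂ (ℂ ⊗[ℝ] V)}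
    (hl : InPer (LinearMap.BilinForm.baseChange ℂ B) l)
    (h : conjRefl B v '' (l : Set (ℂ ⊗[ℝ] V)) = l) :
    v ∈ (l.restrictScalars ℝ).map (reC V) := by
  obtain ⟨u, hu, hu0, hneg⟩ : ∃ u ∈ l, u ≠ 0 ∧ conjRefl B v u = -u := by
    obtain ⟨w, hw0, hw⟩ := exists_span_singleton_of_finrank_eq_one hl.1
    have hwl : w ∈ l := hw ▸ Submodule.mem_span_singleton_self w
    by_cases hfix : w - conjRefl B v w = 0
    · refine ⟨Complex.I • w, l.smul_mem _ hwl, smul_ne_zero Complex.I_ne_zero hw0, ?_⟩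
      rw [conjRefl_smul, ← sub_eq_zero.1 hfix, Complex.conj_I, neg_smul]
    · have hmem : conjRefl B v w ∈ (l : Set (ℂ ⊗[ℝ] V)) := h ▸ Set.mem_image_of_mem _ hwl
      refine ⟨w - conjRefl B v w, l.sub_mem hwl hmem, hfix, ?_⟩
      rw [map_sub, conjRefl_conjRefl B hv, neg_sub]
  have hx0 := hl.reC_ne_zero hu hu0
  have hx : reflVec B v (reC V u) = -reC V u := by rw [← reC_conjRefl, hneg, map_neg]
  set x := reC V u with hxu
  have hxv : x = ((B v v)⁻¹ * B x v) • v := by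
    rw [reflVec_apply, smul_smul, sub_eq_iff_eq_add, eq_comm, neg_add_eq_sub,
      sub_eq_iff_eq_add, ← two_smul ℝ x, mul_assoc, mul_smul] at hx
    exact (smul_right_injective V (two_ne_zero (α := ℝ)) hx).symm
  set t := (B v v)⁻¹ * B x v with ht
  have ht0 : t ≠ 0 := fun h0 => hx0 (by rw [hxv, h0, zero_smul])
  refine ⟨t⁻¹ • u, (l.restrictScalars ℝ).smul_mem _ hu, ?_⟩
  rw [map_smul, ← hxu, hxv, smul_smul, inv_mul_cancel₀ ht0, one_smul]

theorem InPer.image_eq_of_mem_map_reC {B : LinearMap.BilinForm ℝ V} (hB : B.IsSymm) {v : V}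
    (hv : B v v ≠ 0) {l : Submodule ℂ (ℂ ⊗[ℝ] V)}
    (hl : InPer (LinearMap.BilinForm.baseChange ℂ B) l)
    (h : v ∈ (l.restrictScalars ℝ).map (reC V)) :
    conjRefl B v '' (l : Set (ℂ ⊗[ℝ] V)) = l := by
  obtain ⟨u, hu, huv⟩ := h
  have hul : u ∈ l := hu
  have hu0 : u ≠ 0 := by
    rintro rfl
    rw [map_zero] at huv
    exact hv (by simp [← huv])
  have hneg : conjRefl B v u = -u := by
    obtain ⟨y, hy⟩ := exists_eq_one_tmul_reC_add_I_tmul u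
    rw [huv] at hy
    have hyv : B y v = 0 := by
      have h₀ := congrArg Complex.im (hl.2.1 u hul)
      have hs : B v y = B y v := hB.eq v y
      rw [hy] at h₀
      simp [LinearMap.BilinForm.baseChange_tmul, hs] at h₀
      linarith
    have hry : reflVec B v y = y := by simp [reflVec_apply, hyv]
    have hrv : reflVec B v v = -v := by
      rw [reflVec_apply, smul_smul, mul_assoc, inv_mul_cancel₀ hv, mul_one, two_smul]
      abel
    rw [hy, map_add, conjRefl_tmul, conjRefl_tmul, hry, hrv, map_one, Complex.conj_I,
      TensorProduct.tmul_neg, TensorProduct.neg_tmul, neg_add]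
  have hsub : ∀ w ∈ l, conjRefl B v w ∈ l := by
    intro w hw
    obtain ⟨c, hc⟩ := (finrank_eq_one_iff_of_nonzero' (⟨u, hul⟩ : l)
      (by simpa using hu0)).1 hl.1 ⟨w, hw⟩
    have hc' : c • u = w := congrArg Subtype.val hc
    rw [← hc', conjRefl_smul, hneg]
    exact l.smul_mem _ (l.neg_mem hul)
  refine Set.Subset.antisymm ?_ fun w hw => ⟨_, hsub w hw, conjRefl_conjRefl B hv w⟩
  rintro _ ⟨w, hw, rfl⟩
  exact hsub w hw

end

/-- the map `γ_v`, the composition of the (holomorphic) map induced by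
the reflection `ι_v` with orientation reversal (i.e. complex conjugation on the period
domain model), is an antiholomorphic (i.e. conjugate-linear on the model) involution of
`Gr₊₊ = {l ⊂ V_ℂ : q(l,l) = 0, q(l,l̄) > 0}` whose fixed point set is exactly the set
`Gr₊₊(v)` of (oriented positive 2-planes corresponding to lines whose) real 2-plane
contains `v`. -/
theorem gamma_v_antiholomorphic_involution
    {V : Type*} [AddCommGroup V] [Module ℝ V] [FiniteDimensional ℝ V]
    (B : LinearMap.BilinForm ℝ V) (a b : ℕ)
    (hsig : HasSignature B a b) (ha : 2 ≤ a)
    (hsymm : B.IsSymm) (hnd : B.Nondegenerate)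
    (v : V) (hv : 0 < B v v)
    (Bc : LinearMap.BilinForm ℂ (ℂ ⊗[ℝ] V))
    (hBc : Bc = LinearMap.BilinForm.baseChange ℂ B)
    (γ : (ℂ ⊗[ℝ] V) →ₗ[ℝ] (ℂ ⊗[ℝ] V))
    (hγ : γ = (conjC V).comp
      ((LinearMap.baseChange ℂ (reflVec B v)).restrictScalars ℝ)) :
    -- `γ` is conjugate-linear (antiholomorphic) :
    (∀ (c : ℂ) (w : ℂ ⊗[ℝ] V), γ (c • w) = (starRingEnd ℂ) c • γ w) ∧
    -- `γ` is an involution :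
    (∀ w : ℂ ⊗[ℝ] V, γ (γ w) = w) ∧
    -- `γ` maps the period domain `Gr₊₊` to itself :
    (∀ l : Submodule ℂ (ℂ ⊗[ℝ] V), InPer Bc l →
      ∃ l' : Submodule ℂ (ℂ ⊗[ℝ] V), InPer Bc l' ∧
        (l' : Set (ℂ ⊗[ℝ] V)) = γ '' l) ∧
    -- the fixed points of `γ` on `Gr₊₊` are exactly the planes containing `v` :
    (∀ l : Submodule ℂ (ℂ ⊗[ℝ] V), InPer Bc l →
      ((γ '' (l : Set (ℂ ⊗[ℝ] V)) = (l : Set (ℂ ⊗[ℝ] V))) ↔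
        v ∈ (l.restrictScalars ℝ).map (reC V))) := by
  subst hBc
  obtain rfl : γ = conjRefl B v := hγ
  exact ⟨conjRefl_smul B v, conjRefl_conjRefl B hv.ne',
    fun l hl => ⟨conjReflImage B v l, hl.conjReflImage hsymm hv.ne', rfl⟩,
    fun l hl => ⟨hl.mem_map_reC_of_image_eq hv.ne',
      hl.image_eq_of_mem_map_reC hsymm hv.ne'⟩⟩
end

section
/- (Meyer's theorem, application) Any nondegenerate integral quadratic lattice of rank ≥ 5 that is indefinite represents zero nontrivially: there exists a nonzero lattice vector v with q(v,v) = 0. -/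
open Module

namespace Meyer

/-! ### Hilbert symbols over `ℚ`, given by explicit formulas -/

/-- The prime-to-`p` part of an integer. -/
def unitPart (p : ℕ) (a : ℤ) : ℤ := a / (p : ℤ) ^ padicValInt p a

/-- The bilinear symbol on signs: it is `-1` exactly when both arguments are `-1`. -/
def signPair (s t : ℤ) : ℤ := if s = -1 ∧ t = -1 then -1 else 1

/-- The Hilbert symbol of two nonzero integers at the prime `p`. -/
def hilbert (p : ℕ) (a b : ℤ) : ℤ :=
  if p = 2 then
    signPair (ZMod.χ₄ (unitPart p a)) (ZMod.χ₄ (unitPart p b)) *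
      ZMod.χ₈ (unitPart p a) ^ padicValInt p b * ZMod.χ₈ (unitPart p b) ^ padicValInt p a
  else
    jacobiSym (-1) p ^ (padicValInt p a * padicValInt p b) *
      jacobiSym (unitPart p a) p ^ padicValInt p b * jacobiSym (unitPart p b) p ^ padicValInt p a

/-- The Hilbert symbol at the real place. -/
def hilbertReal (a b : ℤ) : ℤ := signPair a.sign b.sign

lemma signPair_comm (s t : ℤ) : signPair s t = signPair t s := by
  simp only [signPair, and_comm]

lemma signPair_mul {s s' : ℤ} (t : ℤ) (hs : s = 1 ∨ s = -1) (hs' : s' = 1 ∨ s' = -1) :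
    signPair (s * s') t = signPair s t * signPair s' t := by
  by_cases ht : t = -1 <;> rcases hs with rfl | rfl <;> rcases hs' with rfl | rfl <;>
    simp [signPair, ht]

lemma signPair_eq (s t : ℤ) : signPair s t = 1 ∨ signPair s t = -1 := by
  unfold signPair
  split_ifs <;> simp

lemma pow_eq_one_or {x : ℤ} (hx : x = 1 ∨ x = -1) (n : ℕ) : x ^ n = 1 ∨ x ^ n = -1 := by
  rcases hx with rfl | rfl
  · simp
  · exact neg_one_pow_eq_or ℤ n

lemma mul_eq_one_or {x y : ℤ} (hx : x = 1 ∨ x = -1) (hy : y = 1 ∨ y = -1) :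
    x * y = 1 ∨ x * y = -1 := by
  rcases hx with rfl | rfl <;> rcases hy with rfl | rfl <;> simp

lemma eq_mul_unitPart (p : ℕ) (a : ℤ) :
    a = (p : ℤ) ^ padicValInt p a * unitPart p a :=
  (Int.mul_ediv_cancel' (padicValInt_dvd a)).symm

lemma not_dvd_unitPart {p : ℕ} (hp : p.Prime) {a : ℤ} (ha : a ≠ 0) :
    ¬ (p : ℤ) ∣ unitPart p a := by
  have := Fact.mk hp
  rintro ⟨c, hc⟩
  have h1 : (p : ℤ) ^ (padicValInt p a + 1) ∣ a := by
    refine ⟨c, ?_⟩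
    conv_lhs => rw [eq_mul_unitPart p a, hc]
    ring
  rcases (padicValInt_dvd_iff _ _).1 h1 with h | h
  · exact ha h
  · omega

lemma padicValInt_pow_mul {p : ℕ} (hp : p.Prime) (k : ℕ) {u : ℤ} (hu : ¬ (p : ℤ) ∣ u) :
    padicValInt p ((p : ℤ) ^ k * u) = k := by
  have := Fact.mk hp
  have hp0 : (p : ℤ) ≠ 0 := by exact_mod_cast hp.ne_zero
  have hu0 : u ≠ 0 := by rintro rfl; simp at hu
  rw [padicValInt.mul (pow_ne_zero _ hp0) hu0, padicValInt.eq_zero_of_not_dvd hu, add_zero]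
  induction k with
  | zero => simp
  | succ k ih =>
    rw [pow_succ, padicValInt.mul (pow_ne_zero _ hp0) hp0, ih, padicValInt.self hp.one_lt]

lemma unitPart_pow_mul {p : ℕ} (hp : p.Prime) (k : ℕ) {u : ℤ} (hu : ¬ (p : ℤ) ∣ u) :
    unitPart p ((p : ℤ) ^ k * u) = u := by
  have hp0 : (p : ℤ) ≠ 0 := by exact_mod_cast hp.ne_zero
  rw [unitPart, padicValInt_pow_mul hp k hu, Int.mul_ediv_cancel_left _ (pow_ne_zero _ hp0)]

lemma padicValInt_of_not_dvd {p : ℕ} {u : ℤ} (hu : ¬ (p : ℤ) ∣ u) : padicValInt p u = 0 :=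
  padicValInt.eq_zero_of_not_dvd hu

lemma unitPart_of_not_dvd {p : ℕ} {u : ℤ} (hu : ¬ (p : ℤ) ∣ u) :
    unitPart p u = u := by
  simp [unitPart, padicValInt.eq_zero_of_not_dvd hu]

lemma unitPart_self {p : ℕ} (hp : p.Prime) : unitPart p p = 1 := by
  have h : ¬ (p : ℤ) ∣ 1 := fun h => hp.one_lt.ne' (by exact_mod_cast Int.eq_one_of_dvd_one (by positivity) h)
  simpa using unitPart_pow_mul hp 1 h

lemma unitPart_mul {p : ℕ} (hp : p.Prime) {a b : ℤ} (ha : a ≠ 0) (hb : b ≠ 0) :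
    unitPart p (a * b) = unitPart p a * unitPart p b := by
  have h : a * b = (p : ℤ) ^ (padicValInt p a + padicValInt p b) *
      (unitPart p a * unitPart p b) := by
    conv_lhs => rw [eq_mul_unitPart p a, eq_mul_unitPart p b]
    ring
  conv_lhs => rw [h]
  exact unitPart_pow_mul hp _ fun hd => (Int.Prime.dvd_mul' hp hd).elim
    (not_dvd_unitPart hp ha) (not_dvd_unitPart hp hb)

lemma chi_four_eq {u : ℤ} (hu : ¬ ((2 : ℕ) : ℤ) ∣ u) :
    ZMod.χ₄ (u : ZMod 4) = 1 ∨ ZMod.χ₄ (u : ZMod 4) = -1 := by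
  rw [ZMod.χ₄_int_eq_if_mod_four]
  split_ifs <;> omega

lemma chi_eight_eq {u : ℤ} (hu : ¬ ((2 : ℕ) : ℤ) ∣ u) :
    ZMod.χ₈ (u : ZMod 8) = 1 ∨ ZMod.χ₈ (u : ZMod 8) = -1 := by
  rw [ZMod.χ₈_int_eq_if_mod_eight]
  split_ifs <;> omega

lemma jacobiSym_eq {p : ℕ} (hp : p.Prime) {u : ℤ} (hu : ¬ (p : ℤ) ∣ u) :
    jacobiSym u p = 1 ∨ jacobiSym u p = -1 :=
  jacobiSym.eq_one_or_neg_one <| by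
    rw [Int.gcd_comm]
    exact (Int.isCoprime_iff_gcd_eq_one).1
      (((Nat.prime_iff_prime_int.1 hp).coprime_iff_not_dvd).2 hu)

lemma not_dvd_one {p : ℕ} (hp : p.Prime) : ¬ (p : ℤ) ∣ 1 := fun h =>
  hp.one_lt.ne' (by exact_mod_cast Int.eq_one_of_dvd_one (by positivity) h)

lemma not_dvd_neg_one {p : ℕ} (hp : p.Prime) : ¬ (p : ℤ) ∣ -1 := by
  rw [dvd_neg]
  exact not_dvd_one hp

lemma hilbert_comm (p : ℕ) (a b : ℤ) : hilbert p a b = hilbert p b a := by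
  unfold hilbert
  split_ifs
  · rw [signPair_comm]; ring
  · rw [mul_comm (padicValInt p a)]; ring

lemma hilbert_mul_left {p : ℕ} (hp : p.Prime) {a a' : ℤ} (b : ℤ) (ha : a ≠ 0) (ha' : a' ≠ 0) :
    hilbert p (a * a') b = hilbert p a b * hilbert p a' b := by
  have := Fact.mk hp
  unfold hilbert
  rw [unitPart_mul hp ha ha', padicValInt.mul ha ha']
  split_ifs with h2
  · subst h2
    push_cast
    rw [map_mul, map_mul, signPair_mul _ (chi_four_eq (not_dvd_unitPart hp ha))
      (chi_four_eq (not_dvd_unitPart hp ha'))]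
    ring
  · rw [jacobiSym.mul_left]
    ring

lemma hilbert_mul_right {p : ℕ} (hp : p.Prime) (a : ℤ) {b b' : ℤ} (hb : b ≠ 0) (hb' : b' ≠ 0) :
    hilbert p a (b * b') = hilbert p a b * hilbert p a b' := by
  rw [hilbert_comm, hilbert_mul_left hp a hb hb', hilbert_comm p b, hilbert_comm p b']

lemma hilbert_eq {p : ℕ} (hp : p.Prime) {a b : ℤ} (ha : a ≠ 0) (hb : b ≠ 0) :
    hilbert p a b = 1 ∨ hilbert p a b = -1 := by
  unfold hilbert
  split_ifs with h2
  · subst h2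
    exact mul_eq_one_or (mul_eq_one_or (signPair_eq _ _)
      (pow_eq_one_or (chi_eight_eq (not_dvd_unitPart hp ha)) _))
      (pow_eq_one_or (chi_eight_eq (not_dvd_unitPart hp hb)) _)
  · exact mul_eq_one_or (mul_eq_one_or (pow_eq_one_or (jacobiSym_eq hp (not_dvd_neg_one hp)) _)
      (pow_eq_one_or (jacobiSym_eq hp (not_dvd_unitPart hp ha)) _))
      (pow_eq_one_or (jacobiSym_eq hp (not_dvd_unitPart hp hb)) _)

lemma hilbert_mul_self {p : ℕ} (hp : p.Prime) {a b : ℤ} (ha : a ≠ 0) (hb : b ≠ 0) :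
    hilbert p a b * hilbert p a b = 1 := by
  rcases hilbert_eq hp ha hb with h | h <;> simp [h]

lemma padicValInt_neg (p : ℕ) (a : ℤ) : padicValInt p (-a) = padicValInt p a := by
  simp [padicValInt]

lemma unitPart_neg (p : ℕ) (a : ℤ) : unitPart p (-a) = -unitPart p a := by
  rw [unitPart, padicValInt_neg, unitPart, Int.neg_ediv_of_dvd (padicValInt_dvd a)]

lemma hilbert_neg_self {p : ℕ} (hp : p.Prime) {a : ℤ} (ha : a ≠ 0) : hilbert p a (-a) = 1 := by
  unfold hilbert
  rw [padicValInt_neg, unitPart_neg]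
  have hu := not_dvd_unitPart hp ha
  split_ifs with h2
  · subst h2
    have h8 : ZMod.χ₈ ((-unitPart 2 a : ℤ) : ZMod 8) = ZMod.χ₈ (unitPart 2 a : ZMod 8) := by
      rw [ZMod.χ₈_int_eq_if_mod_eight, ZMod.χ₈_int_eq_if_mod_eight]
      split_ifs <;> omega
    have h4 : signPair (ZMod.χ₄ (unitPart 2 a : ZMod 4))
        (ZMod.χ₄ ((-unitPart 2 a : ℤ) : ZMod 4)) = 1 := by
      unfold signPair
      rw [ZMod.χ₄_int_eq_if_mod_four, ZMod.χ₄_int_eq_if_mod_four]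
      have hm : unitPart 2 a % 4 = 1 ∧ -unitPart 2 a % 4 = 3 ∨
          unitPart 2 a % 4 = 3 ∧ -unitPart 2 a % 4 = 1 := by omega
      have hu1 : unitPart 2 a % 2 = 1 := by omega
      have hu2 : -unitPart 2 a % 2 = 1 := by omega
      rcases hm with ⟨h, h'⟩ | ⟨h, h'⟩ <;> rw [h, h', hu1, hu2] <;> simp
    rw [h8, h4, one_mul, ← mul_pow]
    rcases chi_eight_eq hu with h | h <;> rw [h] <;> simp
  · have h1 : jacobiSym (-unitPart p a) p = jacobiSym (-1) p * jacobiSym (unitPart p a) p := by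
      rw [← jacobiSym.mul_left, neg_one_mul]
    rw [h1, mul_pow]
    rcases jacobiSym_eq hp hu with h | h <;>
      rcases jacobiSym_eq hp (not_dvd_neg_one hp) with h' | h' <;> rw [h, h'] <;>
      rcases Nat.even_or_odd (padicValInt p a) with e | e <;>
      simp [e.neg_one_pow, Odd.mul, e]

lemma hilbert_self {p : ℕ} (hp : p.Prime) {a : ℤ} (ha : a ≠ 0) :
    hilbert p a a = hilbert p a (-1) := by
  have h : hilbert p a a = hilbert p a (-1 * -a) := by simp
  rw [h, hilbert_mul_right hp a (by norm_num) (neg_ne_zero.2 ha), hilbert_neg_self hp ha, mul_one]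

lemma hilbert_of_not_dvd_left {p : ℕ} (h2 : p ≠ 2) {a b : ℤ} (ha : ¬ (p : ℤ) ∣ a) :
    hilbert p a b = jacobiSym a p ^ padicValInt p b := by
  simp [hilbert, h2, padicValInt_of_not_dvd ha, unitPart_of_not_dvd ha]

lemma hilbert_of_not_dvd {p : ℕ} (h2 : p ≠ 2) {a b : ℤ} (ha : ¬ (p : ℤ) ∣ a)
    (hb : ¬ (p : ℤ) ∣ b) : hilbert p a b = 1 := by
  rw [hilbert_of_not_dvd_left h2 ha, padicValInt_of_not_dvd hb, pow_zero]

lemma hilbert_two_of_odd {a b : ℤ} (ha : ¬ ((2 : ℕ) : ℤ) ∣ a) (hb : ¬ ((2 : ℕ) : ℤ) ∣ b) :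
    hilbert 2 a b = signPair (ZMod.χ₄ a) (ZMod.χ₄ b) := by
  simp [hilbert, padicValInt_of_not_dvd ha, unitPart_of_not_dvd ha, padicValInt_of_not_dvd hb,
    unitPart_of_not_dvd hb]

lemma hilbert_two_of_odd_left {a : ℤ} (ha : ¬ ((2 : ℕ) : ℤ) ∣ a) :
    hilbert 2 a 2 = ZMod.χ₈ a := by
  have h1 : padicValInt 2 2 = 1 := by exact_mod_cast padicValInt.self (p := 2) (by norm_num)
  have h2 : unitPart 2 2 = 1 := by exact_mod_cast unitPart_self Nat.prime_two
  simp [hilbert, padicValInt_of_not_dvd ha, unitPart_of_not_dvd ha, h1, h2, signPair]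

lemma hilbert_congr {p : ℕ} (hp : p.Prime) {u v : ℤ} (b : ℤ) (hu : ¬ (p : ℤ) ∣ u)
    (huv : u ≡ v [ZMOD (p : ℤ) ^ 3]) : hilbert p u b = hilbert p v b := by
  have hv : ¬ (p : ℤ) ∣ v := fun h =>
    hu (((huv.of_dvd (dvd_pow_self _ three_ne_zero)).dvd_iff).2 h)
  unfold hilbert
  rw [padicValInt_of_not_dvd hu, unitPart_of_not_dvd hu, padicValInt_of_not_dvd hv,
    unitPart_of_not_dvd hv]
  split_ifs with h2
  · subst h2
    have h8 : ((u : ℤ) : ZMod 8) = v := (ZMod.intCast_eq_intCast_iff _ _ 8).2 (by simpa using huv)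
    have h4 : ((u : ℤ) : ZMod 4) = v := (ZMod.intCast_eq_intCast_iff _ _ 4).2
      (huv.of_dvd (by norm_num))
    rw [h8, h4]
  · rw [jacobiSym.mod_left u, huv.of_dvd (dvd_pow_self _ three_ne_zero), ← jacobiSym.mod_left]

lemma hilbert_mul_mul_self {p : ℕ} (hp : p.Prime) {a b d : ℤ} (ha : a ≠ 0) (hb : b ≠ 0)
    (hd : d ≠ 0) : hilbert p (a * (d * d)) b = hilbert p a b := by
  rw [hilbert_mul_left hp b ha (mul_ne_zero hd hd), hilbert_mul_left hp b hd hd,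
    hilbert_mul_self hp hd hb, mul_one]

lemma hilbert_mul_mul {p : ℕ} (hp : p.Prime) {a b c : ℤ} (ha : a ≠ 0) (hb : b ≠ 0) (hc : c ≠ 0) :
    hilbert p (a * c) (b * c) = hilbert p a b * hilbert p c (-(a * b)) := by
  have h : -(a * b) = a * (b * -1) := by ring
  rw [h, hilbert_mul_left hp _ ha hc, hilbert_mul_right hp a hb hc, hilbert_mul_right hp c hb hc,
    hilbert_self hp hc, hilbert_mul_right hp c ha (mul_ne_zero hb (by norm_num)),
    hilbert_mul_right hp c hb (by norm_num), hilbert_comm p c a]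
  ring

/-! ### The product formula -/

lemma sign_eq_one_or {a : ℤ} (ha : a ≠ 0) : a.sign = 1 ∨ a.sign = -1 := by
  rcases lt_or_gt_of_ne ha with h | h
  · exact Or.inr (Int.sign_eq_neg_one_of_neg h)
  · exact Or.inl (Int.sign_eq_one_of_pos h)

lemma hilbertReal_eq_one {a b : ℤ} (h : 0 < a ∨ 0 < b) : hilbertReal a b = 1 := by
  unfold hilbertReal signPair
  rw [if_neg]
  rintro ⟨h1, h2⟩
  rw [Int.sign_eq_neg_one_iff_neg] at h1 h2
  omega

/-- The product of the Hilbert symbols at the real place and at the primes in `S`. -/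
def symbolProd (S : Finset ℕ) (a b : ℤ) : ℤ := hilbertReal a b * ∏ p ∈ S, hilbert p a b

section ProductFormula

variable {S : Finset ℕ}

lemma symbolProd_comm (a b : ℤ) : symbolProd S a b = symbolProd S b a := by
  simp only [symbolProd, hilbertReal, signPair_comm a.sign, hilbert_comm _ a]

lemma symbolProd_mul_left (hS : ∀ p ∈ S, p.Prime) {a a' : ℤ} (b : ℤ) (ha : a ≠ 0) (ha' : a' ≠ 0) :
    symbolProd S (a * a') b = symbolProd S a b * symbolProd S a' b := by
  unfold symbolProd
  rw [Finset.prod_congr rfl fun p hp => hilbert_mul_left (hS p hp) b ha ha',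
    Finset.prod_mul_distrib, hilbertReal, Int.sign_mul,
    signPair_mul _ (sign_eq_one_or ha) (sign_eq_one_or ha'), hilbertReal, hilbertReal]
  ring

lemma symbolProd_neg_self (hS : ∀ p ∈ S, p.Prime) {a : ℤ} (ha : a ≠ 0) :
    symbolProd S a (-a) = 1 := by
  rw [symbolProd, Finset.prod_congr rfl fun p hp => hilbert_neg_self (hS p hp) ha,
    hilbertReal_eq_one (by omega)]
  simp

lemma eq_one_of_multiplicative {f : ℤ → ℤ} (hmul : ∀ a b, a ≠ 0 → b ≠ 0 → f (a * b) = f a * f b)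
    (hneg : f (-1) = 1) (hprime : ∀ p ∈ S, p.Prime → f p = 1) {a : ℤ} (ha : a ≠ 0)
    (haS : ∀ p : ℕ, p.Prime → (p : ℤ) ∣ a → p ∈ S) : f a = 1 := by
  have key : ∀ n : ℕ, n ≠ 0 → (∀ p : ℕ, p.Prime → p ∣ n → p ∈ S) → f n = 1 := by
    intro n
    induction n using induction_on_primes with
    | zero => simp
    | one => exact fun _ _ => by simpa [hneg] using hmul (-1) (-1) (by norm_num) (by norm_num)
    | prime_mul p m hp ih =>
      intro hm hS
      have hm0 : m ≠ 0 := right_ne_zero_of_mul hm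
      rw [Nat.cast_mul, hmul _ _ (by exact_mod_cast hp.ne_zero) (by exact_mod_cast hm0),
        hprime p (hS p hp (dvd_mul_right p m)) hp,
        ih hm0 fun q hq h => hS q hq (h.mul_left p), one_mul]
  have h := key a.natAbs (Int.natAbs_ne_zero.2 ha) fun p hp h => haS p hp (Int.natCast_dvd.2 h)
  rcases Int.natAbs_eq a with h' | h'
  · rwa [← h'] at h
  · rw [h', ← neg_one_mul, hmul _ _ (by norm_num) (by simpa using ha), h, hneg, one_mul]

lemma not_dvd_of_prime_ne {p q : ℕ} (hp : p.Prime) (hq : q.Prime) (h : p ≠ q) :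
    ¬ (p : ℤ) ∣ q := fun hd =>
  h ((Nat.prime_dvd_prime_iff_eq hp hq).1 (by exact_mod_cast hd))

lemma hilbert_self_right {p : ℕ} (hp : p.Prime) (h2 : p ≠ 2) {a : ℤ} (ha : ¬ (p : ℤ) ∣ a) :
    hilbert p a p = jacobiSym a p := by
  rw [hilbert_of_not_dvd_left h2 ha, padicValInt.self hp.one_lt, pow_one]

lemma symbolProd_neg_one_neg_one (hS : ∀ p ∈ S, p.Prime) (h2 : 2 ∈ S) :
    symbolProd S (-1) (-1) = 1 := by
  rw [symbolProd, Finset.prod_eq_single_of_mem 2 h2 fun p hp hp2 =>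
    hilbert_of_not_dvd hp2 (not_dvd_neg_one (hS p hp)) (not_dvd_neg_one (hS p hp)),
    hilbert_two_of_odd (by norm_num) (by norm_num)]
  decide

lemma symbolProd_neg_one_prime (hS : ∀ p ∈ S, p.Prime) (h2 : 2 ∈ S) {q : ℕ} (hq : q ∈ S) :
    symbolProd S (-1) q = 1 := by
  have hqp := hS q hq
  rw [symbolProd, hilbertReal_eq_one (Or.inr (by exact_mod_cast hqp.pos)), one_mul]
  by_cases hq2 : q = 2
  · subst hq2
    refine Finset.prod_eq_one fun p hp => ?_
    by_cases hp2 : p = 2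
    · subst hp2
      rw [Nat.cast_ofNat, hilbert_two_of_odd_left (by norm_num)]
      decide
    · exact hilbert_of_not_dvd hp2 (not_dvd_neg_one (hS p hp))
        (not_dvd_of_prime_ne (hS p hp) hqp hp2)
  · rw [Finset.prod_eq_mul_of_mem 2 q h2 hq (Ne.symm hq2) fun p hp hpq =>
      hilbert_of_not_dvd hpq.1 (not_dvd_neg_one (hS p hp))
        (not_dvd_of_prime_ne (hS p hp) hqp hpq.2),
      hilbert_self_right hqp hq2 (not_dvd_neg_one hqp),
      jacobiSym.at_neg_one (hqp.odd_of_ne_two hq2),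
      hilbert_two_of_odd (by norm_num) (not_dvd_of_prime_ne Nat.prime_two hqp (Ne.symm hq2))]
    have h4 := chi_four_eq (not_dvd_of_prime_ne Nat.prime_two hqp (Ne.symm hq2))
    rw [Int.cast_natCast] at h4 ⊢
    have h1 : ZMod.χ₄ ((-1 : ℤ) : ZMod 4) = -1 := by decide
    rw [h1]
    rcases h4 with h | h <;> rw [h] <;> simp [signPair]

lemma symbolProd_two_prime (hS : ∀ p ∈ S, p.Prime) (h2 : 2 ∈ S) {q : ℕ} (hq : q ∈ S)
    (hq2 : q ≠ 2) : symbolProd S q 2 = 1 := by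
  have hqp := hS q hq
  have hodd := not_dvd_of_prime_ne Nat.prime_two hqp (Ne.symm hq2)
  have htwo {p : ℕ} (hp : p ∈ S) (hp2 : p ≠ 2) : ¬ (p : ℤ) ∣ 2 := by
    exact_mod_cast not_dvd_of_prime_ne (hS p hp) Nat.prime_two hp2
  have htriv (p : ℕ) (hp : p ∈ S) (hpq : p ≠ 2 ∧ p ≠ q) : hilbert p q 2 = 1 :=
    hilbert_of_not_dvd hpq.1 (not_dvd_of_prime_ne (hS p hp) hqp hpq.2) (htwo hp hpq.1)
  rw [symbolProd, hilbertReal_eq_one (by simp), one_mul,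
    Finset.prod_eq_mul_of_mem 2 q h2 hq (Ne.symm hq2) htriv,
    hilbert_comm q, hilbert_self_right hqp hq2 (htwo hq hq2),
    hilbert_two_of_odd_left hodd, jacobiSym.at_two (hqp.odd_of_ne_two hq2)]
  have h8 := chi_eight_eq hodd
  rw [Int.cast_natCast] at h8 ⊢
  rcases h8 with h | h <;> rw [h] <;> rfl

lemma symbolProd_odd_primes (hS : ∀ p ∈ S, p.Prime) (h2 : 2 ∈ S) {q r : ℕ} (hq : q ∈ S)
    (hr : r ∈ S) (hq2 : q ≠ 2) (hr2 : r ≠ 2) (hqr : q ≠ r) : symbolProd S q r = 1 := by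
  have hqp := hS q hq
  have hrp := hS r hr
  have hq_odd := hqp.odd_of_ne_two hq2
  have hr_odd := hrp.odd_of_ne_two hr2
  have hq2' := not_dvd_of_prime_ne Nat.prime_two hqp (Ne.symm hq2)
  have hr2' := not_dvd_of_prime_ne Nat.prime_two hrp (Ne.symm hr2)
  have hprod : ∏ p ∈ S, hilbert p q r = hilbert 2 q r * (hilbert q q r * hilbert r q r) := by
    rw [← Finset.mul_prod_erase S _ h2, Finset.prod_eq_mul_of_mem q r
      (Finset.mem_erase.2 ⟨hq2, hq⟩) (Finset.mem_erase.2 ⟨hr2, hr⟩) hqr]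
    intro p hp hpqr
    obtain ⟨hp2, hp⟩ := Finset.mem_erase.1 hp
    exact hilbert_of_not_dvd hp2 (not_dvd_of_prime_ne (hS p hp) hqp hpqr.1)
      (not_dvd_of_prime_ne (hS p hp) hrp hpqr.2)
  rw [symbolProd, hprod, hilbertReal_eq_one (Or.inl (by exact_mod_cast hqp.pos)), one_mul,
    hilbert_self_right hrp hr2 (not_dvd_of_prime_ne hrp hqp (Ne.symm hqr)), hilbert_comm q,
    hilbert_self_right hqp hq2 (not_dvd_of_prime_ne hqp hrp hqr), hilbert_two_of_odd hq2' hr2']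
  have h1 := jacobiSym_eq hqp (not_dvd_of_prime_ne hqp hrp hqr)
  rw [ZMod.χ₄_int_eq_if_mod_four, ZMod.χ₄_int_eq_if_mod_four]
  have hq4 : q % 4 = 1 ∨ q % 4 = 3 := by have := Nat.odd_iff.1 hq_odd; omega
  have hr4 : r % 4 = 1 ∨ r % 4 = 3 := by have := Nat.odd_iff.1 hr_odd; omega
  have hqi : (q : ℤ) % 2 ≠ 0 := by have := Nat.odd_iff.1 hq_odd; omega
  have hri : (r : ℤ) % 2 ≠ 0 := by have := Nat.odd_iff.1 hr_odd; omega
  rw [if_neg hqi, if_neg hri]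
  rcases hq4 with hq4 | hq4
  · have hq4' : (q : ℤ) % 4 = 1 := by omega
    rw [jacobiSym.quadratic_reciprocity_one_mod_four hq4 hr_odd, if_pos hq4']
    rcases h1 with h | h <;> rw [h] <;> simp [signPair]
  · have hq4' : (q : ℤ) % 4 ≠ 1 := by omega
    rw [if_neg hq4']
    rcases hr4 with hr4 | hr4
    · have hr4' : (r : ℤ) % 4 = 1 := by omega
      rw [jacobiSym.quadratic_reciprocity_one_mod_four hr4 hq_odd, if_pos hr4']
      have h1 := jacobiSym_eq hrp (not_dvd_of_prime_ne hrp hqp (Ne.symm hqr))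
      rcases h1 with h | h <;> rw [h] <;> simp [signPair]
    · have hr4' : (r : ℤ) % 4 ≠ 1 := by omega
      rw [jacobiSym.quadratic_reciprocity_three_mod_four hq4 hr4, if_neg hr4']
      rcases h1 with h | h <;> rw [h] <;> simp [signPair]

lemma symbolProd_prime_prime (hS : ∀ p ∈ S, p.Prime) (h2 : 2 ∈ S) {q r : ℕ} (hq : q ∈ S)
    (hr : r ∈ S) : symbolProd S q r = 1 := by
  have hq0 : (q : ℤ) ≠ 0 := by exact_mod_cast (hS q hq).ne_zero
  by_cases hqr : q = r
  · subst hqr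
    have h : (q : ℤ) = -1 * -q := by ring
    have h' : symbolProd S q q = symbolProd S (-1 * -q) q := by rw [← h]
    rw [h', symbolProd_mul_left hS _ (by norm_num) (neg_ne_zero.2 hq0),
      symbolProd_neg_one_prime hS h2 hq, symbolProd_comm, symbolProd_neg_self hS hq0, one_mul]
  · by_cases hq2 : q = 2
    · subst hq2
      rw [symbolProd_comm]
      exact symbolProd_two_prime hS h2 hr (Ne.symm hqr)
    · by_cases hr2 : r = 2
      · subst hr2
        exact symbolProd_two_prime hS h2 hq hq2
      · exact symbolProd_odd_primes hS h2 hq hr hq2 hr2 hqr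

/-- Hilbert's product formula over `ℚ`. -/
theorem symbolProd_eq_one (hS : ∀ p ∈ S, p.Prime) (h2 : 2 ∈ S) {a b : ℤ} (ha : a ≠ 0) (hb : b ≠ 0)
    (haS : ∀ p : ℕ, p.Prime → (p : ℤ) ∣ a → p ∈ S)
    (hbS : ∀ p : ℕ, p.Prime → (p : ℤ) ∣ b → p ∈ S) : symbolProd S a b = 1 := by
  refine eq_one_of_multiplicative (f := fun a => symbolProd S a b)
    (fun x y hx hy => symbolProd_mul_left hS b hx hy) ?_ (fun q hq _ => ?_) ha haS
  · rw [symbolProd_comm]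
    exact eq_one_of_multiplicative (f := fun b => symbolProd S b (-1))
      (fun x y hx hy => symbolProd_mul_left hS _ hx hy) (symbolProd_neg_one_neg_one hS h2)
      (fun r hr _ => by rw [symbolProd_comm]; exact symbolProd_neg_one_prime hS h2 hr) hb hbS
  · rw [symbolProd_comm]
    exact eq_one_of_multiplicative (f := fun b => symbolProd S b q)
      (fun x y hx hy => symbolProd_mul_left hS _ hx hy) (symbolProd_neg_one_prime hS h2 hq)
      (fun r hr _ => symbolProd_prime_prime hS h2 hr hq) hb hbS

/-- If all Hilbert symbols but possibly one are trivial, then all of them are. -/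
theorem hilbert_eq_one_of_forall_mem (hS : ∀ p ∈ S, p.Prime) (h2 : 2 ∈ S) {l : ℕ} (hl : l.Prime)
    (hlS : l ∉ S) {a b : ℤ} (ha : a ≠ 0) (hb : b ≠ 0)
    (haS : ∀ p : ℕ, p.Prime → (p : ℤ) ∣ a → p = l ∨ p ∈ S)
    (hbS : ∀ p : ℕ, p.Prime → (p : ℤ) ∣ b → p = l ∨ p ∈ S)
    (hreal : 0 < a ∨ 0 < b) (h : ∀ p ∈ S, hilbert p a b = 1) {p : ℕ} (hp : p.Prime) :
    hilbert p a b = 1 := by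
  by_cases hpS : p ∈ S
  · exact h p hpS
  by_cases hpl : p = l
  · subst hpl
    have key := symbolProd_eq_one (S := insert p S)
      (fun q hq => (Finset.mem_insert.1 hq).elim (fun e => e ▸ hl) (hS q))
      (Finset.mem_insert_of_mem h2) ha hb
      (fun q hq hd => Finset.mem_insert.2 (haS q hq hd))
      (fun q hq hd => Finset.mem_insert.2 (hbS q hq hd))
    rwa [symbolProd, hilbertReal_eq_one hreal, Finset.prod_insert hlS, Finset.prod_eq_one h,
      one_mul, mul_one] at key
  · exact hilbert_of_not_dvd (fun e : p = 2 => hpS (e ▸ h2))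
      (fun hd => (haS p hp hd).elim hpl hpS) (fun hd => (hbS p hp hd).elim hpl hpS)

end ProductFormula

/-! ### Ternary forms -/

lemma exists_squarefree_mul_sq {n : ℤ} (hn : n ≠ 0) :
    ∃ m d : ℤ, n = m * (d * d) ∧ Squarefree m ∧ d ≠ 0 := by
  obtain ⟨k, d, hkd, hk⟩ := Nat.sq_mul_squarefree n.natAbs
  have hsign := Int.sign_mul_natAbs n
  refine ⟨n.sign * k, d, ?_, ?_, ?_⟩
  · rw [← hkd] at hsign
    push_cast at hsign
    linear_combination -hsign
  · rw [← Int.squarefree_natAbs, Int.natAbs_mul, Int.natAbs_sign_of_ne_zero hn]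
    simpa using hk
  · rintro h
    apply hn
    rw [← Int.natAbs_eq_zero, ← hkd]
    simp [Int.natCast_eq_zero.1 h]

lemma exists_dvd_sq_sub {n : ℕ} (a : ℤ) (hn : Squarefree n)
    (h : ∀ p : ℕ, p.Prime → p ∣ n → ∃ t : ℤ, (p : ℤ) ∣ t ^ 2 - a) :
    ∃ t : ℤ, (n : ℤ) ∣ t ^ 2 - a := by
  induction n using induction_on_primes with
  | zero => exact absurd hn not_squarefree_zero
  | one => exact ⟨0, by simp⟩
  | prime_mul p m hp ih =>
    obtain ⟨hcop, -, hm⟩ := Nat.squarefree_mul_iff.1 hn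
    obtain ⟨t, ht⟩ := ih hm fun q hq hd => h q hq (hd.mul_left p)
    obtain ⟨s, hs⟩ := h p hp (dvd_mul_right p m)
    have hcop' : IsCoprime (p : ℤ) m := Nat.isCoprime_iff_coprime.2 hcop
    obtain ⟨u, v, huv⟩ := hcop'
    refine ⟨t * (u * p) + s * (v * m), ?_⟩
    rw [Nat.cast_mul]
    refine IsCoprime.mul_dvd ⟨u, v, huv⟩ ?_ ?_
    · obtain ⟨k, hk⟩ := hs
      refine ⟨k + (t - s) * u * (2 * s + (t - s) * u * p), ?_⟩
      have e : t * (u * p) + s * (v * m) = s + (t - s) * u * p := by linear_combination s * huv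
      rw [e]
      linear_combination hk
    · obtain ⟨k, hk⟩ := ht
      refine ⟨k + (s - t) * v * (2 * t + (s - t) * v * m), ?_⟩
      have e : t * (u * p) + s * (v * m) = t + (s - t) * v * m := by linear_combination t * huv
      rw [e]
      linear_combination hk

lemma padicValInt_self_mul {p : ℕ} (hp : p.Prime) {u : ℤ} (hu : ¬ (p : ℤ) ∣ u) :
    padicValInt p (p * u) = 1 := by
  simpa using padicValInt_pow_mul hp 1 hu

lemma unitPart_self_mul {p : ℕ} (hp : p.Prime) {u : ℤ} (hu : ¬ (p : ℤ) ∣ u) :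
    unitPart p (p * u) = u := by
  simpa using unitPart_pow_mul hp 1 hu

lemma exists_eq_mul_of_squarefree {p : ℕ} (hp : p.Prime) {a : ℤ} (ha : Squarefree a)
    (hpa : (p : ℤ) ∣ a) : ∃ u : ℤ, a = p * u ∧ ¬ (p : ℤ) ∣ u := by
  obtain ⟨u, rfl⟩ := hpa
  refine ⟨u, rfl, fun h => ?_⟩
  exact (Nat.prime_iff_prime_int.1 hp).not_isUnit (ha p (mul_dvd_mul_left _ h))

lemma jacobiSym_eq_one_of_sq {p : ℕ} (hp : p.Prime) {a t : ℤ} (ha : ¬ (p : ℤ) ∣ a)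
    (h : (p : ℤ) ∣ t ^ 2 - a) : jacobiSym a p = 1 := by
  have ht : ¬ (p : ℤ) ∣ t := fun hd => ha (by
    simpa using dvd_sub (hd.trans (dvd_pow_self t two_ne_zero)) h)
  rw [jacobiSym.mod_left, ← Int.emod_emod_of_dvd _ dvd_rfl,
    (Int.modEq_iff_dvd.2 h : a % p = t ^ 2 % p), Int.emod_emod_of_dvd _ dvd_rfl,
    ← jacobiSym.mod_left, jacobiSym.pow_left]
  rcases jacobiSym_eq hp ht with h | h <;> simp [h]

lemma hilbert_eq_one_of_add_eq_sq {p : ℕ} (hp : p.Prime) (h2 : p ≠ 2) {a c t : ℤ}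
    (ha : Squarefree a) (h : a + c = t ^ 2) : hilbert p a c = 1 := by
  by_cases hpa : (p : ℤ) ∣ a
  · by_cases hpc : (p : ℤ) ∣ c
    · obtain ⟨u, rfl, hu⟩ := exists_eq_mul_of_squarefree hp ha hpa
      have hpt : (p : ℤ) ∣ t := Int.Prime.dvd_pow' hp (h ▸ dvd_add hpa hpc)
      obtain ⟨s, rfl⟩ := hpt
      have hc : c = p * (p * s ^ 2 - u) := by linear_combination h
      have hv : ¬ (p : ℤ) ∣ p * s ^ 2 - u := by
        rwa [dvd_sub_right (dvd_mul_right _ _)]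
      have hJ : jacobiSym (p * s ^ 2 - u) p = jacobiSym (-1) p * jacobiSym u p := by
        rw [← jacobiSym.mul_left, jacobiSym.mod_left, jacobiSym.mod_left (-1 * u)]
        congr 1
        exact Int.modEq_iff_dvd.2 ⟨-s ^ 2, by ring⟩
      subst hc
      simp only [hilbert, h2, if_false, padicValInt_self_mul hp hu, padicValInt_self_mul hp hv,
        unitPart_self_mul hp hu, unitPart_self_mul hp hv, hJ, mul_one, pow_one]
      rcases jacobiSym_eq hp hu with h | h <;>
        rcases jacobiSym_eq hp (not_dvd_neg_one hp) with h' | h' <;> simp [h, h']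
    · rw [hilbert_comm, hilbert_of_not_dvd_left h2 hpc,
        jacobiSym_eq_one_of_sq hp hpc (t := t) (by rwa [← h, add_sub_cancel_right]), one_pow]
  · by_cases hpc : (p : ℤ) ∣ c
    · rw [hilbert_of_not_dvd_left h2 hpa,
        jacobiSym_eq_one_of_sq hp hpa (t := t) (by rwa [← h, add_sub_cancel_left]), one_pow]
    · exact hilbert_of_not_dvd h2 hpa hpc

lemma exists_dvd_sq_sub_of_hilbert {a b : ℤ} (hb : Squarefree b)
    (h : ∀ p : ℕ, p.Prime → p ≠ 2 → hilbert p a b = 1) : ∃ t : ℤ, b ∣ t ^ 2 - a := by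
  obtain ⟨t, ht⟩ := exists_dvd_sq_sub (n := b.natAbs) a (Int.squarefree_natAbs.2 hb) (by
    intro p hp hpb
    have hpb : (p : ℤ) ∣ b := Int.natCast_dvd.2 hpb
    by_cases hpa : (p : ℤ) ∣ a
    · exact ⟨0, by simpa using hpa⟩
    by_cases h2 : p = 2
    · subst h2
      refine ⟨a, ?_⟩
      have : a ^ 2 - a = a * (a - 1) := by ring
      rw [this]
      exact (Int.even_mul_pred_self a).two_dvd
    · obtain ⟨u, rfl, hu⟩ := exists_eq_mul_of_squarefree hp hb hpb
      have hJ := h p hp h2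
      have := Fact.mk hp
      have hpa' : (a : ZMod p) ≠ 0 := by rwa [Ne, ZMod.intCast_zmod_eq_zero_iff_dvd]
      rw [hilbert_of_not_dvd_left h2 hpa, padicValInt_self_mul hp hu, pow_one,
        ← jacobiSym.legendreSym.to_jacobiSym, legendreSym.eq_one_iff p hpa'] at hJ
      obtain ⟨r, hr⟩ := hJ
      obtain ⟨t, rfl⟩ := ZMod.intCast_surjective r
      refine ⟨t, (ZMod.intCast_zmod_eq_zero_iff_dvd _ p).1 ?_⟩
      push_cast
      rw [hr]
      ring)
  exact ⟨t, Int.natAbs_dvd.1 ht⟩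

/-- The descent step in Legendre's theorem. -/
lemma legendre_descent {a b : ℤ} (ha : Squarefree a) (hb : Squarefree b)
    (hab : |a| ≤ |b|) (hpos : 0 < a ∨ 0 < b)
    (h : ∀ p : ℕ, p.Prime → p ≠ 2 → hilbert p a b = 1)
    (ih : ∀ b' : ℤ, Squarefree b' → |b'| < |b| → (0 < a ∨ 0 < b') →
      (∀ p : ℕ, p.Prime → p ≠ 2 → hilbert p a b' = 1) →
      ∃ x y z : ℤ, ¬ (x = 0 ∧ y = 0 ∧ z = 0) ∧ z ^ 2 = a * x ^ 2 + b' * y ^ 2) :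
    ∃ x y z : ℤ, ¬ (x = 0 ∧ y = 0 ∧ z = 0) ∧ z ^ 2 = a * x ^ 2 + b * y ^ 2 := by
  have ha0 := ha.ne_zero
  have hb0 := hb.ne_zero
  have hapos := abs_pos.2 ha0
  by_cases hb1 : |b| ≤ 1
  · rcases hpos with hpos | hpos
    · refine ⟨1, 0, 1, by simp, ?_⟩
      rw [abs_of_pos hpos] at hab
      have : a = 1 := by omega
      simp [this]
    · refine ⟨0, 1, 1, by simp, ?_⟩
      rw [abs_of_pos hpos] at hb1
      have : b = 1 := by omega
      simp [this]
  obtain ⟨t, ht, htb⟩ : ∃ t : ℤ, b ∣ t ^ 2 - a ∧ 2 * |t| ≤ |b| := by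
    obtain ⟨s, hs⟩ := exists_dvd_sq_sub_of_hilbert hb h
    have hd : b ∣ s - Int.bmod s b.natAbs := by
      rw [← Int.natAbs_dvd]
      exact Int.dvd_self_sub_bmod
    refine ⟨Int.bmod s b.natAbs, ?_, ?_⟩
    · have e : (Int.bmod s b.natAbs) ^ 2 - a =
          (s ^ 2 - a) - (s - Int.bmod s b.natAbs) * (s + Int.bmod s b.natAbs) := by ring
      rw [e]
      exact dvd_sub hs (hd.mul_right _)
    · have hpos : 0 < b.natAbs := Int.natAbs_pos.2 hb0
      have h1 := Int.bmod_le (x := s) hpos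
      have h2 := Int.le_bmod (x := s) hpos
      rw [Int.abs_eq_natAbs b]
      rcases abs_cases (Int.bmod s b.natAbs) with ⟨e, -⟩ | ⟨e, -⟩ <;> rw [e] <;> omega
  obtain ⟨b', hb'⟩ := ht
  by_cases hb'0 : b' = 0
  · exact ⟨1, 0, t, by simp, by rw [hb'0] at hb'; linear_combination hb'⟩
  obtain ⟨m, u, rfl, hm, hu⟩ := exists_squarefree_mul_sq hb'0
  have hu2 : 0 < u * u := mul_self_pos.2 hu
  have hat : a ≠ t ^ 2 := by
    rintro rfl
    rw [sub_self] at hb'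
    exact mul_ne_zero hb0 hb'0 hb'.symm
  have hmb : |m| < |b| := by
    have h1 : |b| * (|m| * (u * u)) ≤ |t| ^ 2 + |a| := by
      rw [← abs_of_pos hu2, ← abs_mul, ← abs_mul, ← hb', ← abs_pow]
      exact abs_sub _ _
    have h2 : |m| ≤ |m| * (u * u) := le_mul_of_one_le_right (abs_nonneg m) hu2
    have h3 : |b| * |m| ≤ |b| * (|m| * (u * u)) := mul_le_mul_of_nonneg_left h2 (abs_nonneg b)
    by_contra! hle
    have h4 : |b| * |b| ≤ |b| * |m| := mul_le_mul_of_nonneg_left hle (abs_nonneg b)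
    nlinarith [abs_nonneg t]
  obtain ⟨x, y, z, hxyz, hz⟩ := ih m hm hmb (by
    rcases lt_or_gt_of_ne ha0 with hneg | hpos'
    · right
      have hbpos : 0 < b := hpos.resolve_left (not_lt.2 hneg.le)
      have h1 : 0 < b * (m * (u * u)) := by rw [← hb']; nlinarith [sq_nonneg t]
      exact pos_of_mul_pos_left (pos_of_mul_pos_right h1 hbpos.le) hu2.le
    · exact Or.inl hpos') (by
    intro p hp h2
    have h1 := hilbert_eq_one_of_add_eq_sq hp h2 ha (c := b * (m * (u * u))) (t := t)
      (by rw [← hb']; ring)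
    rwa [hilbert_mul_right hp a hb0 hb'0, h p hp h2, one_mul, hilbert_comm,
      hilbert_mul_mul_self hp hm.ne_zero ha0 hu, hilbert_comm] at h1)
  refine ⟨z + x * t, m * u * y, z * t + a * x, ?_, ?_⟩
  · rintro ⟨h1, h2, h3⟩
    have hx : x * (a - t ^ 2) = 0 := by linear_combination h3 - t * h1
    have hx0 : x = 0 := (mul_eq_zero.1 hx).resolve_right (sub_ne_zero.2 hat)
    have hy0 : y = 0 := (mul_eq_zero.1 h2).resolve_left (mul_ne_zero hm.ne_zero hu)
    exact hxyz ⟨hx0, hy0, by simpa [hx0] using h1⟩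
  · linear_combination (t ^ 2 - a) * hz + m * y ^ 2 * hb'

lemma legendre_squarefree {a b : ℤ} (ha : Squarefree a) (hb : Squarefree b)
    (hpos : 0 < a ∨ 0 < b) (h : ∀ p : ℕ, p.Prime → p ≠ 2 → hilbert p a b = 1) :
    ∃ x y z : ℤ, ¬ (x = 0 ∧ y = 0 ∧ z = 0) ∧ z ^ 2 = a * x ^ 2 + b * y ^ 2 := by
  induction hN : a.natAbs + b.natAbs using Nat.strong_induction_on generalizing a b with
  | _ N ih =>
    rcases le_total |a| |b| with hab | hab
    · refine legendre_descent ha hb hab hpos h fun b' hb' hlt hpos' h' => ?_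
      rw [Int.abs_eq_natAbs, Int.abs_eq_natAbs] at hlt
      exact ih (a.natAbs + b'.natAbs) (by omega) ha hb' hpos' h' rfl
    · obtain ⟨x, y, z, h0, hz⟩ := legendre_descent hb ha hab hpos.symm
        (fun p hp h2 => by rw [hilbert_comm]; exact h p hp h2) fun a' ha' hlt hpos' h' => by
          rw [Int.abs_eq_natAbs, Int.abs_eq_natAbs] at hlt
          exact ih (b.natAbs + a'.natAbs) (by omega) hb ha' hpos' h' rfl
      exact ⟨y, x, z, fun ⟨hy, hx, hz⟩ => h0 ⟨hx, hy, hz⟩, by linear_combination hz⟩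

/-- Legendre's theorem in terms of Hilbert symbols. -/
theorem exists_ternary_zero {a b c : ℤ} (ha : a ≠ 0) (hb : b ≠ 0) (hc : c ≠ 0)
    (hpos : 0 < a * c ∨ 0 < b * c) (h : ∀ p : ℕ, p.Prime → hilbert p (a * c) (b * c) = 1) :
    ∃ x y z : ℤ, ¬ (x = 0 ∧ y = 0 ∧ z = 0) ∧ a * x ^ 2 + b * y ^ 2 = c * z ^ 2 := by
  obtain ⟨A, s, hA, hA_sq, hs⟩ := exists_squarefree_mul_sq (mul_ne_zero ha hc)
  obtain ⟨B, u, hB, hB_sq, hu⟩ := exists_squarefree_mul_sq (mul_ne_zero hb hc)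
  rw [hA, hB] at hpos
  obtain ⟨x, y, z, h0, hz⟩ := legendre_squarefree hA_sq hB_sq
    (hpos.imp (fun h => pos_of_mul_pos_left h (mul_self_nonneg s))
      (fun h => pos_of_mul_pos_left h (mul_self_nonneg u))) (fun p hp _ => by
      have hp1 := h p hp
      rwa [hA, hB, hilbert_mul_mul_self hp hA_sq.ne_zero (hB ▸ mul_ne_zero hb hc) hs,
        hilbert_comm, hilbert_mul_mul_self hp hB_sq.ne_zero hA_sq.ne_zero hu, hilbert_comm] at hp1)
  refine ⟨c * (x * u), c * (y * s), z * s * u, ?_, ?_⟩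
  · simpa [hc, hs, hu] using h0
  · linear_combination c * x ^ 2 * u ^ 2 * hA + c * y ^ 2 * s ^ 2 * hB - c * s ^ 2 * u ^ 2 * hz

/-! ### Local solvability -/

lemma exists_hilbert_eq_neg_one_of_odd {p : ℕ} (hp : p.Prime) (h2 : p ≠ 2) {a : ℤ}
    (ha : Odd (padicValInt p a)) : ∃ d : ℤ, d ≠ 0 ∧ hilbert p a d = -1 := by
  have := Fact.mk hp
  obtain ⟨r, hr⟩ := FiniteField.exists_nonsquare (F := ZMod p) (by rwa [ZMod.ringChar_zmod_n])
  obtain ⟨d, rfl⟩ := ZMod.intCast_surjective r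
  have hd0 : (d : ZMod p) ≠ 0 := fun h => hr (h ▸ IsSquare.zero)
  have hd : ¬ (p : ℤ) ∣ d := fun h => hd0 ((ZMod.intCast_zmod_eq_zero_iff_dvd d p).2 h)
  refine ⟨d, fun h => hd (h ▸ dvd_zero _), ?_⟩
  have hJ : jacobiSym d p ≠ 1 := by
    rw [← jacobiSym.legendreSym.to_jacobiSym]
    exact fun h => hr ((legendreSym.eq_one_iff p hd0).1 h)
  rw [hilbert_comm, hilbert_of_not_dvd_left h2 hd, (jacobiSym_eq hp hd).resolve_left hJ,
    ha.neg_one_pow]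

lemma hilbert_two_two_five : hilbert 2 2 5 = -1 := by
  rw [hilbert_comm, hilbert_two_of_odd_left (by norm_num)]
  decide

lemma exists_hilbert_ne_one {p : ℕ} (hp : p.Prime) :
    ∃ n d : ℤ, n ≠ 0 ∧ d ≠ 0 ∧ hilbert p n d = -1 := by
  by_cases h2 : p = 2
  · exact ⟨2, 5, by norm_num, by norm_num, h2 ▸ hilbert_two_two_five⟩
  · obtain ⟨d, hd, h⟩ := exists_hilbert_eq_neg_one_of_odd hp h2 (a := p)
      (by rw [padicValInt.self hp.one_lt]; exact odd_one)
    exact ⟨p, d, by exact_mod_cast hp.ne_zero, hd, h⟩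

/-- Every nontrivial square class has a nontrivial class orthogonal to it. -/
lemma exists_orthogonal {p : ℕ} (hp : p.Prime) {b : ℤ} (hb : b ≠ 0)
    (hnt : ∃ d : ℤ, d ≠ 0 ∧ hilbert p b d = -1) :
    ∃ k d : ℤ, k ≠ 0 ∧ d ≠ 0 ∧ hilbert p k b = 1 ∧ hilbert p k d = -1 := by
  by_cases htriv : ∃ d : ℤ, d ≠ 0 ∧ hilbert p (-b) d = -1
  · obtain ⟨d, hd, h⟩ := htriv
    exact ⟨-b, d, neg_ne_zero.2 hb, hd, by rw [hilbert_comm, hilbert_neg_self hp hb], h⟩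
  have htriv {d : ℤ} (hd : d ≠ 0) : hilbert p (-b) d = 1 :=
    (hilbert_eq hp (neg_ne_zero.2 hb) hd).resolve_right fun h => htriv ⟨d, hd, h⟩
  have hbd {d : ℤ} (hd : d ≠ 0) : hilbert p b d = hilbert p (-1) d := by
    have h := hilbert_mul_left hp (a := -1) (a' := -b) d (by norm_num) (neg_ne_zero.2 hb)
    rwa [neg_mul_neg, one_mul, htriv hd, mul_one] at h
  by_cases h2 : p = 2
  · subst h2
    refine ⟨2, 5, by norm_num, by norm_num, ?_, hilbert_two_two_five⟩
    rw [hilbert_comm, hbd (by norm_num), hilbert_two_of_odd_left (by norm_num)]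
    decide
  · obtain ⟨d, hd, h⟩ := hnt
    refine ⟨-1, d, by norm_num, hd, ?_, by rwa [← hbd hd]⟩
    rw [hilbert_comm, hbd (by norm_num),
      hilbert_of_not_dvd h2 (not_dvd_neg_one hp) (not_dvd_neg_one hp)]

/-- A binary form represents a class that avoids any prescribed square class. -/
lemma exists_represented_avoiding {p : ℕ} (hp : p.Prime) {a₁ a₂ m : ℤ} (h₁ : a₁ ≠ 0) (h₂ : a₂ ≠ 0)
    (hm : m ≠ 0) : ∃ q : ℤ, q ≠ 0 ∧ hilbert p a₁ a₂ * hilbert p q (-(a₁ * a₂)) = 1 ∧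
      ∃ d : ℤ, d ≠ 0 ∧ hilbert p (q * m) d = -1 := by
  have hb : -(a₁ * a₂) ≠ 0 := neg_ne_zero.2 (mul_ne_zero h₁ h₂)
  have hself : hilbert p a₁ a₂ = hilbert p a₁ (-(a₁ * a₂)) := by
    have h : -(a₁ * a₂) = -a₁ * a₂ := by ring
    rw [h, hilbert_mul_right hp a₁ (neg_ne_zero.2 h₁) h₂, hilbert_neg_self hp h₁, one_mul]
  obtain ⟨k, d, hk, hd, hkb, hkd⟩ : ∃ k d : ℤ, k ≠ 0 ∧ d ≠ 0 ∧
      hilbert p k (-(a₁ * a₂)) = 1 ∧ hilbert p k d = -1 := by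
    by_cases hnt : ∃ d : ℤ, d ≠ 0 ∧ hilbert p (-(a₁ * a₂)) d = -1
    · exact exists_orthogonal hp hb hnt
    · obtain ⟨n, d, hn, hd, h⟩ := exists_hilbert_ne_one hp
      refine ⟨n, d, hn, hd, ?_, h⟩
      rw [hilbert_comm]
      exact (hilbert_eq hp hb hn).resolve_right fun h => hnt ⟨n, hn, h⟩
  rcases hilbert_eq hp (mul_ne_zero h₁ hm) hd with h | h
  · refine ⟨a₁ * k, mul_ne_zero h₁ hk, ?_, d, hd, ?_⟩
    · rw [hilbert_mul_left hp _ h₁ hk, hkb, mul_one, hself, hilbert_mul_self hp h₁ hb]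
    · rw [mul_right_comm, hilbert_mul_left hp _ (mul_ne_zero h₁ hm) hk, h, hkd, one_mul]
  · exact ⟨a₁, h₁, by rw [hself, hilbert_mul_self hp h₁ hb], d, hd, h⟩

/-- Independent square classes can be paired to prescribed signs. -/
lemma exists_hilbert_eq_eq {p : ℕ} (hp : p.Prime) {b c δ η : ℤ} (hb : b ≠ 0) (hc : c ≠ 0)
    (hbc : ∃ d : ℤ, d ≠ 0 ∧ hilbert p (b * c) d = -1) (hδ : δ = 1 ∨ δ = -1) (hη : η = 1 ∨ η = -1)
    (hbδ : (∀ d : ℤ, d ≠ 0 → hilbert p b d = 1) → δ = 1)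
    (hcη : (∀ d : ℤ, d ≠ 0 → hilbert p c d = 1) → η = 1) :
    ∃ r : ℤ, r ≠ 0 ∧ hilbert p b r = δ ∧ hilbert p c r = η := by
  obtain ⟨d, hd, hbcd⟩ := hbc
  rw [hilbert_mul_left hp d hb hc] at hbcd
  have one_right {a : ℤ} (ha : a ≠ 0) : hilbert p a 1 = 1 := by
    have h := hilbert_mul_right hp a one_ne_zero one_ne_zero
    rw [one_mul] at h
    rcases hilbert_eq hp ha one_ne_zero with h' | h' <;> rw [h'] at h ⊢
    norm_num at h
  have hneg {a : ℤ} (ha : a ≠ 0) {ε : ℤ} (hε : ε = 1 ∨ ε = -1)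
      (h : (∀ d : ℤ, d ≠ 0 → hilbert p a d = 1) → ε = 1) :
      ε = 1 ∨ (ε = -1 ∧ ∃ d : ℤ, d ≠ 0 ∧ hilbert p a d = -1) := by
    rcases hε with hε | hε
    · exact Or.inl hε
    · refine Or.inr ⟨hε, ?_⟩
      by_contra! hcon
      have := h fun d hd => (hilbert_eq hp ha hd).resolve_right (hcon d hd)
      omega
  have hmul {a x y : ℤ} (hx : x ≠ 0) (hy : y ≠ 0) :
      hilbert p a (x * y) = hilbert p a x * hilbert p a y := hilbert_mul_right hp a hx hy
  rcases hneg hb hδ hbδ with rfl | ⟨rfl, x, hx, hbx⟩ <;>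
    rcases hneg hc hη hcη with rfl | ⟨rfl, y, hy, hcy⟩
  · exact ⟨1, one_ne_zero, one_right hb, one_right hc⟩
  · rcases hilbert_eq hp hb hy with hby | hby
    · exact ⟨y, hy, hby, hcy⟩
    rcases hilbert_eq hp hb hd with hbd | hbd
    · exact ⟨d, hd, hbd, by simpa [hbd] using hbcd⟩
    · refine ⟨y * d, mul_ne_zero hy hd, by rw [hmul hy hd, hby, hbd]; rfl, ?_⟩
      rw [hbd] at hbcd
      rw [hmul hy hd, hcy]
      omega
  · rcases hilbert_eq hp hc hx with hcx | hcx
    · exact ⟨x, hx, hbx, hcx⟩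
    rcases hilbert_eq hp hc hd with hcd | hcd
    · exact ⟨d, hd, by simpa [hcd] using hbcd, hcd⟩
    · refine ⟨x * d, mul_ne_zero hx hd, ?_, by rw [hmul hx hd, hcx, hcd]; rfl⟩
      rw [hcd] at hbcd
      rw [hmul hx hd, hbx]
      omega
  · rcases hilbert_eq hp hc hx with hcx | hcx
    · rcases hilbert_eq hp hb hy with hby | hby
      · exact ⟨x * y, mul_ne_zero hx hy, by rw [hmul hx hy, hbx, hby]; rfl,
          by rw [hmul hx hy, hcx, hcy]; rfl⟩
      · exact ⟨y, hy, hby, hcy⟩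
    · exact ⟨x, hx, hbx, hcx⟩

/-- The local condition for splitting off `⟨a₃, a₄⟩` from `⟨a₃, a₄, a₅, q⟩`. -/
lemma exists_common_represented {p : ℕ} (hp : p.Prime) {a₃ a₄ a₅ q : ℤ} (h₃ : a₃ ≠ 0)
    (h₄ : a₄ ≠ 0) (h₅ : a₅ ≠ 0) (hq : q ≠ 0)
    (hnt : ∃ d : ℤ, d ≠ 0 ∧ hilbert p (q * (a₃ * a₄ * a₅)) d = -1) :
    ∃ r : ℤ, r ≠ 0 ∧ hilbert p a₃ a₄ * hilbert p r (-(a₃ * a₄)) = 1 ∧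
      hilbert p a₅ q * hilbert p (-r) (-(a₅ * q)) = 1 := by
  have triv {a b : ℤ} (ha : a ≠ 0) (hb : b ≠ 0)
      (h : ∀ d : ℤ, d ≠ 0 → hilbert p (-(a * b)) d = 1) : hilbert p a b = 1 := by
    have h' := h a ha
    rwa [hilbert_comm, ← neg_mul, hilbert_mul_right hp a (neg_ne_zero.2 ha) hb,
      hilbert_neg_self hp ha, one_mul] at h'
  have hb : -(a₃ * a₄) ≠ 0 := neg_ne_zero.2 (mul_ne_zero h₃ h₄)
  have hc : -(a₅ * q) ≠ 0 := neg_ne_zero.2 (mul_ne_zero h₅ hq)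
  have hbc : q * (a₃ * a₄ * a₅) = -(a₃ * a₄) * -(a₅ * q) := by ring
  have hneg : (-1 : ℤ) ≠ 0 := by norm_num
  rw [hbc] at hnt
  obtain ⟨r, hr, h1, h2⟩ := exists_hilbert_eq_eq hp hb hc hnt (hilbert_eq hp h₃ h₄)
    (mul_eq_one_or (hilbert_eq hp h₅ hq) (hilbert_eq hp hc hneg)) (triv h₃ h₄)
    (fun h => by rw [triv h₅ hq h, h (-1) hneg, one_mul])
  refine ⟨r, hr, by rw [hilbert_comm p r, h1, hilbert_mul_self hp h₃ h₄], ?_⟩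
  rw [← neg_one_mul r, hilbert_mul_left hp _ hneg hr, hilbert_comm p r, h2, hilbert_comm p (-1)]
  have h3 := hilbert_mul_self hp h₅ hq
  have h4 := hilbert_mul_self hp hc hneg
  linear_combination hilbert p (-(a₅ * q)) (-1) * hilbert p (-(a₅ * q)) (-1) * h3 + h4

/-! ### Approximation by Dirichlet's theorem -/

lemma exists_prime_modEq {S : Finset ℕ} (hS : ∀ p ∈ S, p.Prime) {c : ℕ → ℤ}
    (hc : ∀ p ∈ S, ¬ (p : ℤ) ∣ c p) :
    ∃ l : ℕ, l.Prime ∧ l ∉ S ∧ ∀ p ∈ S, (l : ℤ) ≡ c p [ZMOD (p : ℤ) ^ 3] := by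
  obtain ⟨k, hk⟩ : ∃ k : ℤ, ∀ p ∈ S, k ≡ c p [ZMOD (p : ℤ) ^ 3] := by
    obtain ⟨k, hk⟩ := Nat.chineseRemainderOfFinset (fun p => (c p % (p : ℤ) ^ 3).toNat)
      (fun p => p ^ 3) S (fun p hp => pow_ne_zero _ (hS p hp).ne_zero)
      (fun p hp q hq hpq => Nat.Coprime.pow _ _ ((Nat.coprime_primes (hS p hp) (hS q hq)).2 hpq))
    refine ⟨k, fun p hp => ?_⟩
    have h := Int.natCast_modEq_iff.2 (hk p hp)
    have hp3 : (p : ℤ) ^ 3 ≠ 0 := pow_ne_zero _ (by exact_mod_cast (hS p hp).ne_zero)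
    rw [Int.toNat_of_nonneg (Int.emod_nonneg _ hp3), Nat.cast_pow] at h
    exact h.trans (Int.mod_modEq _ _)
  have hcop : IsCoprime k ((∏ p ∈ S, p ^ 3 : ℕ) : ℤ) := by
    rw [Nat.cast_prod]
    refine IsCoprime.prod_right fun p hp => ?_
    rw [Nat.cast_pow]
    refine IsCoprime.pow_right (IsCoprime.symm ?_)
    rw [(Nat.prime_iff_prime_int.1 (hS p hp)).coprime_iff_not_dvd]
    intro hd
    exact hc p hp ((((hk p hp).of_dvd (dvd_pow_self _ three_ne_zero)).dvd_iff).1 hd)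
  obtain ⟨l, hl, hlp, hlk⟩ := Nat.forall_exists_prime_gt_and_zmodEq (∑ p ∈ S, p)
    (Finset.prod_ne_zero_iff.2 fun p hp => pow_ne_zero 3 (hS p hp).ne_zero) hcop
  refine ⟨l, hlp, fun h => ?_, fun p hp => (hlk.of_dvd ?_).trans (hk p hp)⟩
  · exact absurd (Finset.single_le_sum (f := fun p : ℕ => p) (fun _ _ => Nat.zero_le _) h)
      (not_le.2 hl)
  · exact_mod_cast Finset.dvd_prod_of_mem (fun p => p ^ 3) hp

/-- Prescribed sign and local square classes at the primes of `S` are those of an integer with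
exactly one prime factor `l` outside `S`, which occurs to the first power. -/
theorem exists_approximation {S : Finset ℕ} (hS : ∀ p ∈ S, p.Prime) {x : ℕ → ℤ}
    (hx : ∀ p ∈ S, x p ≠ 0) {ε : ℤ} (hε : ε = 1 ∨ ε = -1) :
    ∃ (q : ℤ) (l : ℕ), l.Prime ∧ l ∉ S ∧ 0 < ε * q ∧ padicValInt l q = 1 ∧
      (∀ p : ℕ, p.Prime → (p : ℤ) ∣ q → p = l ∨ p ∈ S) ∧
      ∀ p ∈ S, ∀ b : ℤ, b ≠ 0 → hilbert p q b = hilbert p (x p) b := by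
  set K : ℕ → ℤ := fun p => ε * ∏ s ∈ S.erase p, (s : ℤ) ^ padicValInt s (x s) with hK
  have hεu : IsUnit ε := Int.isUnit_iff.2 hε
  have prime_dvd_prod {p : ℕ} (hp : p.Prime) {T : Finset ℕ} (hT : T ⊆ S)
      (h : (p : ℤ) ∣ ε * ∏ s ∈ T, (s : ℤ) ^ padicValInt s (x s)) : p ∈ T := by
    rw [hεu.dvd_mul_left, (Nat.prime_iff_prime_int.1 hp).dvd_finsetProd_iff] at h
    obtain ⟨s, hs, h⟩ := h
    have h := Int.Prime.dvd_pow' hp h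
    by_contra hpT
    exact not_dvd_of_prime_ne hp (hS s (hT hs)) (fun e => hpT (e ▸ hs)) h
  have hKp {p : ℕ} (hp : p ∈ S) : ¬ (p : ℤ) ∣ K p := fun h => by
    simpa using prime_dvd_prod (hS p hp) (Finset.erase_subset p S) h
  have hK0 {p : ℕ} (hp : p ∈ S) : K p ≠ 0 := fun h => hKp hp (h ▸ dvd_zero _)
  have hcong {p : ℕ} (hp : p ∈ S) : ¬ (p : ℤ) ∣ K p * unitPart p (x p) := fun h =>
    (Int.Prime.dvd_mul' (hS p hp) h).elim (hKp hp) (not_dvd_unitPart (hS p hp) (hx p hp))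
  obtain ⟨l, hl, hlS, hlc⟩ := exists_prime_modEq hS fun p hp => hcong hp
  set P : ℤ := ε * ∏ s ∈ S, (s : ℤ) ^ padicValInt s (x s) with hP
  have hPl : ¬ (l : ℤ) ∣ P := fun h => hlS (prime_dvd_prod hl subset_rfl h)
  have hl0 : (l : ℤ) ≠ 0 := by exact_mod_cast hl.ne_zero
  refine ⟨l * P, l, hl, hlS, ?_, padicValInt_self_mul hl hPl, fun p hp h => ?_, fun p hp b hb => ?_⟩
  · have h1 : ε * ε = 1 := by rcases hε with rfl | rfl <;> rfl
    have h2 : ε * (l * P) = l * ∏ s ∈ S, (s : ℤ) ^ padicValInt s (x s) := by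
      rw [hP]
      linear_combination (l * ∏ s ∈ S, (s : ℤ) ^ padicValInt s (x s)) * h1
    rw [h2]
    exact mul_pos (by exact_mod_cast hl.pos)
      (Finset.prod_pos fun s hs => pow_pos (by exact_mod_cast (hS s hs).pos) _)
  · rcases Int.Prime.dvd_mul' hp h with h | h
    · exact Or.inl (by_contra fun e => not_dvd_of_prime_ne hp hl e h)
    · exact Or.inr (prime_dvd_prod hp subset_rfl h)
  · have hpp := hS p hp
    have hp0 : (p : ℤ) ^ padicValInt p (x p) ≠ 0 :=
      pow_ne_zero _ (by exact_mod_cast hpp.ne_zero)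
    have hPK : P = (p : ℤ) ^ padicValInt p (x p) * K p := by
      rw [hP, hK, ← Finset.mul_prod_erase S _ hp]
      ring
    have hu0 : unitPart p (x p) ≠ 0 := fun h =>
      not_dvd_unitPart hpp (hx p hp) (h ▸ dvd_zero _)
    have hlp : ¬ (p : ℤ) ∣ l := not_dvd_of_prime_ne hpp hl fun e => hlS (e ▸ hp)
    conv_rhs => rw [eq_mul_unitPart p (x p)]
    rw [hPK, hilbert_mul_left hpp b hl0 (mul_ne_zero hp0 (hK0 hp)),
      hilbert_congr hpp b hlp (hlc p hp), hilbert_mul_left hpp b (hK0 hp) hu0,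
      hilbert_mul_left hpp b hp0 (hK0 hp), hilbert_mul_left hpp b hp0 hu0]
    have h1 := hilbert_mul_self hpp (hK0 hp) hb
    linear_combination hilbert p (unitPart p (x p)) b *
      hilbert p ((p : ℤ) ^ padicValInt p (x p)) b * h1

/-! ### Quinary forms -/

/-- Meyer's theorem for diagonal forms. -/
theorem exists_quinary_zero {a₁ a₂ a₃ a₄ a₅ : ℤ} (h₁ : 0 < a₁) (h₂ : a₂ < 0) (h₃ : a₃ ≠ 0)
    (h₄ : a₄ ≠ 0) (h₅ : a₅ ≠ 0) :
    ∃ x₁ x₂ x₃ x₄ x₅ : ℤ, ¬ (x₁ = 0 ∧ x₂ = 0 ∧ x₃ = 0 ∧ x₄ = 0 ∧ x₅ = 0) ∧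
      a₁ * x₁ ^ 2 + a₂ * x₂ ^ 2 + a₃ * x₃ ^ 2 + a₄ * x₄ ^ 2 + a₅ * x₅ ^ 2 = 0 := by
  have h₁' := h₁.ne'
  have h₂' := h₂.ne
  set N : ℤ := 2 * (a₁ * a₂ * a₃ * a₄ * a₅) with hN
  have hN0 : N ≠ 0 := by simp [hN, h₁', h₂', h₃, h₄, h₅]
  set S : Finset ℕ := N.natAbs.primeFactors with hSdef
  have hS (p : ℕ) (hp : p ∈ S) : p.Prime := Nat.prime_of_mem_primeFactors hp
  have hmem {a : ℤ} (ha : a ∣ N) (p : ℕ) (hp : p.Prime) (hd : (p : ℤ) ∣ a) : p ∈ S :=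
    Nat.mem_primeFactors.2 ⟨hp, Int.natCast_dvd.1 (hd.trans ha), Int.natAbs_ne_zero.2 hN0⟩
  have h2S : 2 ∈ S := hmem (dvd_mul_right 2 _) 2 Nat.prime_two dvd_rfl
  have hm₁ := hmem (a := a₁) ⟨2 * (a₂ * a₃ * a₄ * a₅), by rw [hN]; ring⟩
  have hm₂ := hmem (a := a₂) ⟨2 * (a₁ * a₃ * a₄ * a₅), by rw [hN]; ring⟩
  have hm₃ := hmem (a := a₃) ⟨2 * (a₁ * a₂ * a₄ * a₅), by rw [hN]; ring⟩
  have hm₄ := hmem (a := a₄) ⟨2 * (a₁ * a₂ * a₃ * a₅), by rw [hN]; ring⟩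
  have hm₅ := hmem (a := a₅) ⟨2 * (a₁ * a₂ * a₃ * a₄), by rw [hN]; ring⟩
  have h₃₄₅ : a₃ * a₄ * a₅ ≠ 0 := mul_ne_zero (mul_ne_zero h₃ h₄) h₅
  have h₁₂ : -(a₁ * a₂) ≠ 0 := neg_ne_zero.2 (mul_ne_zero h₁' h₂')
  have h₃₄ : -(a₃ * a₄) ≠ 0 := neg_ne_zero.2 (mul_ne_zero h₃ h₄)
  have hloc (p : ℕ) : ∃ x : ℤ, p ∈ S → x ≠ 0 ∧
      hilbert p a₁ a₂ * hilbert p x (-(a₁ * a₂)) = 1 ∧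
      ∃ d : ℤ, d ≠ 0 ∧ hilbert p (x * (a₃ * a₄ * a₅)) d = -1 := by
    by_cases hp : p ∈ S
    · obtain ⟨x, hx⟩ := exists_represented_avoiding (hS p hp) h₁' h₂' h₃₄₅
      exact ⟨x, fun _ => hx⟩
    · exact ⟨0, fun h => absurd h hp⟩
  choose x hx using hloc
  obtain ⟨q, l, hl, hlS, hq_sign, hlq, hqS, hqx⟩ := exists_approximation hS
    (fun p hp => (hx p hp).1) (ε := -a₅.sign) (by have := sign_eq_one_or h₅; omega)
  have hq : q ≠ 0 := by rintro rfl; simp at hq_sign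
  have hQ {p : ℕ} (hp : p.Prime) : hilbert p (a₁ * q) (a₂ * q) = 1 := by
    refine hilbert_eq_one_of_forall_mem hS h2S hl hlS (mul_ne_zero h₁' hq) (mul_ne_zero h₂' hq)
      (fun p hp hd => (Int.Prime.dvd_mul' hp hd).elim (fun h => Or.inr (hm₁ p hp h)) (hqS p hp))
      (fun p hp hd => (Int.Prime.dvd_mul' hp hd).elim (fun h => Or.inr (hm₂ p hp h)) (hqS p hp))
      ?_ (fun p hp => ?_) hp
    · exact hq.lt_or_gt.symm.imp (mul_pos h₁) (mul_pos_of_neg_of_neg h₂)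
    · rw [hilbert_mul_mul (hS p hp) h₁' h₂' hq, hqx p hp _ h₁₂]
      exact (hx p hp).2.1
  set T : Finset ℕ := insert l S with hTdef
  have hT (p : ℕ) (hp : p ∈ T) : p.Prime :=
    (Finset.mem_insert.1 hp).elim (fun e => e ▸ hl) (hS p)
  have hST {p : ℕ} (hp : p ∈ S) : p ∈ T := Finset.mem_insert_of_mem hp
  have hloc' (p : ℕ) : ∃ y : ℤ, p ∈ T → y ≠ 0 ∧
      hilbert p a₃ a₄ * hilbert p y (-(a₃ * a₄)) = 1 ∧
      hilbert p a₅ q * hilbert p (-y) (-(a₅ * q)) = 1 := by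
    by_cases hp : p ∈ T
    · obtain ⟨y, hy⟩ := exists_common_represented (hT p hp) h₃ h₄ h₅ hq (by
        rcases Finset.mem_insert.1 hp with rfl | hpS
        · refine exists_hilbert_eq_neg_one_of_odd hl (fun e => hlS (e ▸ h2S)) ?_
          have := Fact.mk hl
          have hnd : ¬ (p : ℤ) ∣ a₃ * a₄ * a₅ := fun h => hlS <|
            (Int.Prime.dvd_mul' hl h).elim (fun h => (Int.Prime.dvd_mul' hl h).elim
              (hm₃ p hl) (hm₄ p hl)) (hm₅ p hl)
          rw [padicValInt.mul hq h₃₄₅, hlq, padicValInt_of_not_dvd hnd]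
          exact odd_one
        · obtain ⟨hx0, -, d, hd, h⟩ := hx p hpS
          refine ⟨d, hd, ?_⟩
          rwa [hilbert_mul_left (hS p hpS) d hq h₃₄₅, hqx p hpS d hd,
            ← hilbert_mul_left (hS p hpS) d hx0 h₃₄₅])
      exact ⟨y, fun _ => hy⟩
    · exact ⟨0, fun h => absurd h hp⟩
  choose y hy using hloc'
  obtain ⟨r, k, hk, hkT, hr_sign, -, hrT, hry⟩ := exists_approximation hT
    (fun p hp => (hy p hp).1) (sign_eq_one_or h₃)
  have hr : r ≠ 0 := by rintro rfl; simp at hr_sign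
  have hr' : -r ≠ 0 := neg_ne_zero.2 hr
  have hneg : (-1 : ℤ) ≠ 0 := by norm_num
  have h₅q : -(a₅ * q) ≠ 0 := neg_ne_zero.2 (mul_ne_zero h₅ hq)
  have hrT' (p : ℕ) (hp : p.Prime) (hd : (p : ℤ) ∣ -r) : p = k ∨ p ∈ T :=
    hrT p hp (dvd_neg.1 hd)
  have ha₃r : 0 < a₃ * r := by
    have h := mul_pos (abs_pos.2 h₃) hr_sign
    rwa [← mul_assoc, mul_comm |a₃|, Int.sign_mul_abs] at h
  have ha₅q : a₅ * q < 0 := by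
    have h := mul_pos (abs_pos.2 h₅) hq_sign
    rw [neg_mul, mul_neg, ← mul_assoc, mul_comm |a₅|, Int.sign_mul_abs] at h
    omega
  have hR {p : ℕ} (hp : p.Prime) : hilbert p (a₃ * r) (a₄ * r) = 1 := by
    refine hilbert_eq_one_of_forall_mem hT (hST h2S) hk hkT (mul_ne_zero h₃ hr) (mul_ne_zero h₄ hr)
      (fun p hp hd => (Int.Prime.dvd_mul' hp hd).elim (fun h => Or.inr (hST (hm₃ p hp h)))
        (hrT p hp))
      (fun p hp hd => (Int.Prime.dvd_mul' hp hd).elim (fun h => Or.inr (hST (hm₄ p hp h)))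
        (hrT p hp)) (Or.inl ha₃r) (fun p hp => ?_) hp
    rw [hilbert_mul_mul (hT p hp) h₃ h₄ hr, hry p hp _ h₃₄]
    exact (hy p hp).2.1
  have hpos : 0 < a₅ * -r ∨ 0 < q * -r := by
    rcases h₅.lt_or_gt with h | h <;> rcases hr'.lt_or_gt with h' | h'
    · exact Or.inl (mul_pos_of_neg_of_neg h h')
    · exact Or.inr (mul_pos (pos_of_mul_neg_right ha₅q h.le) h')
    · exact Or.inr (mul_pos_of_neg_of_neg (neg_of_mul_neg_right ha₅q h.le) h')
    · exact Or.inl (mul_pos h h')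
  have hQR {p : ℕ} (hp : p.Prime) : hilbert p (a₅ * -r) (q * -r) = 1 := by
    refine hilbert_eq_one_of_forall_mem hT (hST h2S) hk hkT (mul_ne_zero h₅ hr')
      (mul_ne_zero hq hr')
      (fun p hp hd => (Int.Prime.dvd_mul' hp hd).elim (fun h => Or.inr (hST (hm₅ p hp h)))
        (hrT' p hp))
      (fun p hp hd => (Int.Prime.dvd_mul' hp hd).elim
        (fun h => Or.inr (Finset.mem_insert.2 (hqS p hp h))) (hrT' p hp)) hpos (fun p hp => ?_) hp
    have hpp := hT p hp
    rw [hilbert_mul_mul hpp h₅ hq hr', ← neg_one_mul r, hilbert_mul_left hpp _ hneg hr,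
      hry p hp _ h₅q, ← hilbert_mul_left hpp _ hneg (hy p hp).1, neg_one_mul]
    exact (hy p hp).2.2
  obtain ⟨x₁, x₂, z, hx0, hz⟩ := exists_ternary_zero h₁' h₂' hq
    (hq.lt_or_gt.symm.imp (mul_pos h₁) (mul_pos_of_neg_of_neg h₂)) fun p hp => hQ hp
  obtain ⟨x₃, x₄, w, hy0, hw⟩ := exists_ternary_zero h₃ h₄ hr (Or.inl ha₃r) fun p hp => hR hp
  obtain ⟨x₅, u, v, hu0, hv⟩ := exists_ternary_zero h₅ hq hr' hpos fun p hp => hQR hp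
  by_cases hz0 : z = 0
  · subst hz0
    exact ⟨x₁, x₂, 0, 0, 0, fun h => hx0 ⟨h.1, h.2.1, rfl⟩, by linear_combination hz⟩
  by_cases hw0 : w = 0
  · subst hw0
    exact ⟨0, 0, x₃, x₄, 0, fun h => hy0 ⟨h.2.2.1, h.2.2.2.1, rfl⟩, by linear_combination hw⟩
  refine ⟨x₁ * u * w, x₂ * u * w, x₃ * v * z, x₄ * v * z, x₅ * z * w, ?_, ?_⟩
  · rintro ⟨e₁, e₂, e₃, e₄, e₅⟩
    simp only [mul_eq_zero, hz0, hw0, or_false] at e₁ e₂ e₃ e₄ e₅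
    refine hu0 ⟨e₅, ?_, ?_⟩
    · by_contra hu
      rw [e₁.resolve_right hu, e₂.resolve_right hu] at hz
      have : q * z ^ 2 = 0 := by linear_combination -hz
      exact mul_ne_zero hq (pow_ne_zero 2 hz0) this
    · by_contra hv
      rw [e₃.resolve_right hv, e₄.resolve_right hv] at hw
      have : r * w ^ 2 = 0 := by linear_combination -hw
      exact mul_ne_zero hr (pow_ne_zero 2 hw0) this
  · linear_combination u ^ 2 * w ^ 2 * hz + v ^ 2 * z ^ 2 * hw + z ^ 2 * w ^ 2 * hv

/-! ### Lattices -/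

section Lattice

variable {M : Type*} [AddCommGroup M] [Module ℤ M]

lemma exists_ne_zero_orthogonal [Module.Finite ℤ M] [Module.Free ℤ M]
    (B : LinearMap.BilinForm ℤ M) {k : ℕ} (hk : k < finrank ℤ M) (w : Fin k → M) :
    ∃ v : M, v ≠ 0 ∧ ∀ i, B (w i) v = 0 := by
  let f : M →ₗ[ℤ] (Fin k → ℤ) := LinearMap.pi fun i => B (w i)
  by_contra! hcon
  have hf : Function.Injective f := by
    rw [← LinearMap.ker_eq_bot, LinearMap.ker_eq_bot']
    intro v hv
    by_contra hv0
    obtain ⟨i, hi⟩ := hcon v hv0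
    exact hi (congrFun hv i)
  have h := LinearMap.finrank_le_finrank_of_injective hf
  rw [finrank_fin_fun] at h
  omega

end Lattice

end Meyer

/-- Meyer's theorem: any nondegenerate integral quadratic lattice of
rank `≥ 5` which is indefinite represents zero nontrivially: there is a nonzero
lattice vector `v` with `q(v,v) = 0`. -/
theorem meyer_indefinite_lattice_represents_zero
    (M : Type*) [AddCommGroup M] [Module ℤ M] [Module.Free ℤ M] [Module.Finite ℤ M]
    (B : LinearMap.BilinForm ℤ M) (hsymm : B.IsSymm) (hnd : B.Nondegenerate)
    (hrank : 5 ≤ Module.finrank ℤ M)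
    -- indefiniteness: the form takes both positive and negative values :
    (hindef : (∃ x : M, 0 < B x x) ∧ (∃ y : M, B y y < 0)) :
    ∃ v : M, v ≠ 0 ∧ B v v = 0 := by
  by_contra! haniso
  obtain ⟨⟨e₁, h₁⟩, y, hy⟩ := hindef
  have hs (a b : M) : B a b = B b a := hsymm.eq a b
  obtain ⟨e₂, h₁₂, h₂⟩ : ∃ e₂ : M, B e₁ e₂ = 0 ∧ B e₂ e₂ < 0 := by
    have expand (a : M) : B a (B e₁ e₁ • y - B e₁ y • e₁) = B e₁ e₁ * B a y - B e₁ y * B a e₁ := by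
      rw [map_sub, map_zsmul, map_zsmul, smul_eq_mul, smul_eq_mul]
    refine ⟨B e₁ e₁ • y - B e₁ y • e₁, by rw [expand]; ring, ?_⟩
    rw [expand, hs (_ - _) y, hs (_ - _) e₁, expand, expand, hs y e₁]
    nlinarith [mul_neg_of_pos_of_neg h₁ (mul_neg_of_pos_of_neg h₁ hy),
      mul_nonneg h₁.le (sq_nonneg (B e₁ y))]
  obtain ⟨e₃, he₃, h₃⟩ := Meyer.exists_ne_zero_orthogonal B (by omega) ![e₁, e₂]
  obtain ⟨e₄, he₄, h₄⟩ := Meyer.exists_ne_zero_orthogonal B (by omega) ![e₁, e₂, e₃]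
  obtain ⟨e₅, he₅, h₅⟩ := Meyer.exists_ne_zero_orthogonal B (by omega) ![e₁, e₂, e₃, e₄]
  have h₁₃ : B e₁ e₃ = 0 := h₃ 0
  have h₂₃ : B e₂ e₃ = 0 := h₃ 1
  have h₁₄ : B e₁ e₄ = 0 := h₄ 0
  have h₂₄ : B e₂ e₄ = 0 := h₄ 1
  have h₃₄ : B e₃ e₄ = 0 := h₄ 2
  have h₁₅ : B e₁ e₅ = 0 := h₅ 0
  have h₂₅ : B e₂ e₅ = 0 := h₅ 1
  have h₃₅ : B e₃ e₅ = 0 := h₅ 2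
  have h₄₅ : B e₄ e₅ = 0 := h₅ 3
  obtain ⟨x₁, x₂, x₃, x₄, x₅, hx, hsum⟩ := Meyer.exists_quinary_zero h₁ h₂ (haniso e₃ he₃)
    (haniso e₄ he₄) (haniso e₅ he₅)
  have expand (a : M) : B a (x₁ • e₁ + x₂ • e₂ + x₃ • e₃ + x₄ • e₄ + x₅ • e₅) =
      x₁ * B a e₁ + x₂ * B a e₂ + x₃ * B a e₃ + x₄ * B a e₄ + x₅ * B a e₅ := by
    simp only [map_add, map_zsmul, smul_eq_mul]
  refine haniso (x₁ • e₁ + x₂ • e₂ + x₃ • e₃ + x₄ • e₄ + x₅ • e₅) (fun hv => hx ?_) ?_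
  · simp only [hv, map_zero] at expand
    have c₁ := expand e₁
    have c₂ := expand e₂
    have c₃ := expand e₃
    have c₄ := expand e₄
    have c₅ := expand e₅
    simp only [hs e₂ e₁, hs e₃ e₁, hs e₄ e₁, hs e₅ e₁, hs e₃ e₂, hs e₄ e₂, hs e₅ e₂, hs e₄ e₃,
      hs e₅ e₃, hs e₅ e₄, h₁₂, h₁₃, h₁₄, h₁₅, h₂₃, h₂₄, h₂₅, h₃₄, h₃₅, h₄₅, mul_zero, zero_add,
      add_zero, zero_eq_mul, h₁.ne', h₂.ne, haniso e₃ he₃, haniso e₄ he₄, haniso e₅ he₅,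
      or_false] at c₁ c₂ c₃ c₄ c₅
    exact ⟨c₁, c₂, c₃, c₄, c₅⟩
  · rw [expand, hs _ e₁, hs _ e₂, hs _ e₃, hs _ e₄, hs _ e₅]
    simp only [expand, hs e₂ e₁, hs e₃ e₁, hs e₄ e₁, hs e₅ e₁, hs e₃ e₂, hs e₄ e₂, hs e₅ e₂,
      hs e₄ e₃, hs e₅ e₃, hs e₅ e₄, h₁₂, h₁₃, h₁₄, h₁₅, h₂₃, h₂₄, h₂₅, h₃₄, h₃₅, h₄₅]
    linear_combination hsum
end
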